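/- Let A = kQ/I be a (locally) gentle algebra and let L' be the set of finite maximal paths of the Koszul dual A# (the finite maximal forbidden paths of A). Then the graded right self-injective dimension of A equals the graded left self-injective dimension of A, and injdim(A) = max{ℓ(p) : p ∈ L'} if L' ≠ ∅; injdim(A) = 0 if A = kÃ_n/(kÃ_n)_{≥2}; and injdim(A) = 1 otherwise. -/

import Mathlib

/- Common framework for (locally) gentle algebras -/

noncomputable section
open scoped BigOperators
open CategoryTheory

namespace LocGentle

/-- A finite connected quiver with at least one vertex and one arrow. -/
structure Quiv where
  V : Type
  Arr : Type
  [fintypeV : Fintype V]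
  [fintypeA : Fintype Arr]
  [decEqV : DecidableEq V]
  [decEqA : DecidableEq Arr]
  src : Arr → V
  tgt : Arr → V
  [nonemptyV : Nonempty V]
  [nonemptyA : Nonempty Arr]
  connected : (SimpleGraph.fromRel (fun v w => ∃ a, src a = v ∧ tgt a = w)).Connected

attribute [instance] Quiv.fintypeV Quiv.fintypeA Quiv.decEqV Quiv.decEqA
  Quiv.nonemptyV Quiv.nonemptyA

variable (Q : Quiv)

/-- in-degree of a vertex -/
def indeg (v : Q.V) : ℕ := (Finset.univ.filter (fun a => Q.tgt a = v)).card

/-- out-degree of a vertex -/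
def outdeg (v : Q.V) : ℕ := (Finset.univ.filter (fun a => Q.src a = v)).card

/-- a list of arrows is composable (forms a path) -/
def Composable (l : List Q.Arr) : Prop := l.Chain' (fun a b => Q.tgt a = Q.src b)

variable {Q}

/-- source vertex of a nonempty word -/
def wSrc? (l : List Q.Arr) : Option Q.V := l.head?.map Q.src

/-- target vertex of a nonempty word -/
def wTgt? (l : List Q.Arr) : Option Q.V := l.getLast?.map Q.tgt

/-- target of a word, with a default value (used for stationary paths) -/
def wTgtD (l : List Q.Arr) (v : Q.V) : Q.V := (l.getLast?.map Q.tgt).getD v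

/-- last arrow of a word, with a (junk) default -/
def wLast (l : List Q.Arr) : Q.Arr := l.getLast?.getD (Classical.arbitrary _)

variable (rel : Q.Arr → Q.Arr → Prop)

/-- A word is allowed (is a basis path of `A = kQ/I`) if consecutive arrows are
composable and no consecutive pair lies in the relation set generating `I`. -/
def AllowedWord (l : List Q.Arr) : Prop :=
  l.Chain' (fun a b => Q.tgt a = Q.src b ∧ ¬ rel a b)

/-- right maximal paths (of positive length) -/
def RightMaxWord (l : List Q.Arr) : Prop :=
  l ≠ [] ∧ AllowedWord rel l ∧ ∀ a : Q.Arr, ¬ AllowedWord rel (l ++ [a])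

/-- left maximal paths (of positive length) -/
def LeftMaxWord (l : List Q.Arr) : Prop :=
  l ≠ [] ∧ AllowedWord rel l ∧ ∀ a : Q.Arr, ¬ AllowedWord rel (a :: l)

/-- finite maximal paths -/
def FiniteMaxWord (l : List Q.Arr) : Prop := RightMaxWord rel l ∧ LeftMaxWord rel l

/-- a word is primitive if it is not a proper power -/
def PrimitiveWord (l : List Q.Arr) : Prop :=
  ∀ (l' : List Q.Arr) (n : ℕ), 2 ≤ n → l ≠ (List.replicate n l').flatten

/-- a primitive cycle `c` with `c² ∉ I`; these represent the infinite maximal paths `c^∞`. -/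
def PrimCycleSq (c : List Q.Arr) : Prop :=
  c ≠ [] ∧ AllowedWord rel (c ++ c) ∧ wTgt? c = wSrc? c ∧ PrimitiveWord c

/-- the maximal path `γ_α` containing `α` is infinite -/
def InfThrough (a : Q.Arr) : Prop := ∃ c, PrimCycleSq rel c ∧ a ∈ c

/-- the maximal path `γ_α` containing `α` is finite -/
def FinThrough (a : Q.Arr) : Prop := ∃ l, FiniteMaxWord rel l ∧ a ∈ l

/-- the rotation of the cycle `c` starting at the arrow `a`; when `a ∈ c` and `c` has no
duplicates this is the primitive cycle `γ_r(a)`. -/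
def rotTo (c : List Q.Arr) (a : Q.Arr) : List Q.Arr :=
  c.dropWhile (fun b => b != a) ++ c.takeWhile (fun b => b != a)

/-- the relation set of the Koszul dual `A#`; its allowed words are the forbidden paths of `A`. -/
def dualRel : Q.Arr → Q.Arr → Prop := fun a b => Q.tgt a = Q.src b ∧ ¬ rel a b

/-- a forbidden path of `A`, i.e. a path of the Koszul dual `A#` -/
def ForbiddenWord (l : List Q.Arr) : Prop := AllowedWord (dualRel rel) l

variable (Q)

/-- The defining conditions (i)-(iv) of a (locally) gentle algebra, in terms of the set of
length-two relations generating the ideal `I`: an algebra satisfying them is gentle if it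
is finite dimensional and locally gentle otherwise. -/
structure IsGentleRel : Prop where
  indeg_le : ∀ v : Q.V, indeg Q v ≤ 2
  outdeg_le : ∀ v : Q.V, outdeg Q v ≤ 2
  rel_comp : ∀ a b : Q.Arr, rel a b → Q.tgt a = Q.src b
  cond_ii : ∀ a b b' : Q.Arr, b ≠ b' → Q.tgt b = Q.src a → Q.tgt b' = Q.src a →
    Xor' (rel b a) (rel b' a)
  cond_iii : ∀ a b b' : Q.Arr, b ≠ b' → Q.tgt a = Q.src b → Q.tgt a = Q.src b' →
    Xor' (rel a b) (rel a b')

/-- `Q` is (as a quiver) the extended Dynkin quiver `Ã_n` (for `n = |Q₀| - 1`):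
every vertex has in-degree and out-degree one. -/
def IsAtilde : Prop := ∀ v : Q.V, indeg Q v = 1 ∧ outdeg Q v = 1

/-- paths of `Q`, including the stationary paths (`w = []`) at each vertex -/
structure Pth where
  s : Q.V
  w : List Q.Arr
  hs : ∀ a ∈ w.head?, Q.src a = s
  hc : Composable Q w

variable {Q}

/-- target of a path -/
def Pth.t (p : Pth Q) : Q.V := wTgtD p.w p.s

/-- length of a path -/
def Pth.len (p : Pth Q) : ℕ := p.w.length

/-- a basis path of `A = kQ/I` -/
def Pth.Allowed (p : Pth Q) : Prop := AllowedWord rel p.w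

end LocGentle
namespace LocGentle

variable (k : Type) [Field k] (Q : Quiv) (rel : Q.Arr → Q.Arr → Prop)

/-- The defining relations presenting `A = kQ/I` as a quotient of the free algebra on
the stationary paths (vertices) and arrows: the path algebra relations together with
the relations `αβ = 0` for the length-two paths `αβ` generating `I`. -/
inductive GARel : FreeAlgebra k (Q.V ⊕ Q.Arr) → FreeAlgebra k (Q.V ⊕ Q.Arr) → Prop
  | idem (v : Q.V) : GARel (FreeAlgebra.ι k (Sum.inl v) * FreeAlgebra.ι k (Sum.inl v))
      (FreeAlgebra.ι k (Sum.inl v))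
  | orth (v w : Q.V) : v ≠ w → GARel (FreeAlgebra.ι k (Sum.inl v) * FreeAlgebra.ι k (Sum.inl w)) 0
  | unit : GARel (∑ v : Q.V, FreeAlgebra.ι k (Sum.inl v)) 1
  | src_mul (a : Q.Arr) : GARel (FreeAlgebra.ι k (Sum.inl (Q.src a)) * FreeAlgebra.ι k (Sum.inr a))
      (FreeAlgebra.ι k (Sum.inr a))
  | mul_tgt (a : Q.Arr) : GARel (FreeAlgebra.ι k (Sum.inr a) * FreeAlgebra.ι k (Sum.inl (Q.tgt a)))
      (FreeAlgebra.ι k (Sum.inr a))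
  | src_zero (v : Q.V) (a : Q.Arr) : v ≠ Q.src a →
      GARel (FreeAlgebra.ι k (Sum.inl v) * FreeAlgebra.ι k (Sum.inr a)) 0
  | tgt_zero (v : Q.V) (a : Q.Arr) : v ≠ Q.tgt a →
      GARel (FreeAlgebra.ι k (Sum.inr a) * FreeAlgebra.ι k (Sum.inl v)) 0
  | rel_zero (a b : Q.Arr) : rel a b →
      GARel (FreeAlgebra.ι k (Sum.inr a) * FreeAlgebra.ι k (Sum.inr b)) 0

/-- The (locally) gentle algebra `A = kQ/I`. -/
abbrev GA := RingQuot (GARel k Q rel)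

/-- the image in `A` of the stationary path at `v` -/
def vtx (v : Q.V) : GA k Q rel := RingQuot.mkAlgHom k _ (FreeAlgebra.ι k (Sum.inl v))

/-- the image in `A` of the arrow `a` -/
def arr (a : Q.Arr) : GA k Q rel := RingQuot.mkAlgHom k _ (FreeAlgebra.ι k (Sum.inr a))

/-- the image in `A` of the word `l` (the product of its arrows) -/
def wordEl (l : List Q.Arr) : GA k Q rel := (l.map (arr k Q rel)).prod

variable {Q}

/-- the image in `A` of a path (a stationary path maps to the corresponding idempotent) -/
def Pth.el (p : Pth Q) : GA k Q rel := vtx k Q rel p.s * wordEl k Q rel p.w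

variable (Q)

/-- the `n`-th graded component `A_n` of `A`, spanned by the images of paths of length `n` -/
def deg (n : ℕ) : Submodule k (GA k Q rel) :=
  Submodule.span k {x | ∃ p : Pth Q, p.Allowed rel ∧ p.len = n ∧ x = p.el k rel}

/-- the augmentation ideal `A₊` (as a `k`-submodule), spanned by paths of positive length -/
def degPlus : Submodule k (GA k Q rel) :=
  Submodule.span k {x | ∃ p : Pth Q, p.Allowed rel ∧ 1 ≤ p.len ∧ x = p.el k rel}

/-- the Hilbert series of `A` (with integer coefficients) -/
def hilb : PowerSeries ℤ :=
  PowerSeries.mk fun n => (Module.finrank k (deg k Q rel n) : ℤ)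

/-- the Hilbert series of `A` (with rational coefficients) -/
def hilbQ : PowerSeries ℚ :=
  PowerSeries.mk fun n => (Module.finrank k (deg k Q rel n) : ℚ)

/-- the number `k_n` of finite maximal paths of length at least `n` -/
def numFMP (n : ℕ) : ℕ := {l : List Q.Arr | FiniteMaxWord rel l ∧ n ≤ l.length}.ncard

/-- the Gelfand-Kirillov dimension of `A`:
`limsup_n log (dim_k A_{≤ n}) / log n`. -/
def GKdim : ℝ :=
  Filter.limsup (fun n : ℕ =>
      Real.log (Module.finrank k ↥(⨆ i ∈ Finset.range (n + 1), deg k Q rel i)) / Real.log n)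
    Filter.atTop

/-- the central element `m_γ` attached to the infinite maximal path `γ = c^∞`:
the sum over the arrows `α` of `c` of the primitive cycle `γ_r(α)` starting at `α`. -/
def mEl (c : List Q.Arr) : GA k Q rel := (c.map fun a => wordEl k Q rel (rotTo c a)).sum

/-- evaluation of a polynomial at `x ∈ A`; `polyEval k Q rel p x` is `p(x)`. -/
def polyEval (p : Polynomial k) (x : GA k Q rel) : GA k Q rel :=
  Polynomial.eval₂ (algebraMap k (GA k Q rel)) x p

end LocGentle
namespace LocGentle

variable (k : Type) [Field k] (Q : Quiv) (rel : Q.Arr → Q.Arr → Prop)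

/-! ### Two-sided ideals and primes -/

/-- a prime (two-sided) ideal -/
def IsPrimeTI (P : TwoSidedIdeal (GA k Q rel)) : Prop :=
  P ≠ ⊤ ∧ ∀ x y : GA k Q rel, (∀ a : GA k Q rel, x * a * y ∈ P) → x ∈ P ∨ y ∈ P

/-- the maximal ideal `𝔪_v` of `A` which does not contain `ε_v`: it is generated by the
stationary paths at the other vertices together with all loops at `v`. -/
def mIdeal (v : Q.V) : TwoSidedIdeal (GA k Q rel) :=
  TwoSidedIdeal.span
    ({x | ∃ w : Q.V, w ≠ v ∧ x = vtx k Q rel w} ∪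
     {x | ∃ a : Q.Arr, Q.src a = v ∧ Q.tgt a = v ∧ x = arr k Q rel a})

/-- the ideal `J_γ` corresponding to the infinite maximal path `γ = c^∞`, generated by
all arrows lying on `γ` -/
def Jgamma (c : List Q.Arr) : TwoSidedIdeal (GA k Q rel) :=
  TwoSidedIdeal.span {x | ∃ a ∈ c, x = arr k Q rel a}

/-- the left annihilator of `J_γ` -/
def annJ (c : List Q.Arr) : Set (GA k Q rel) :=
  {x | ∀ y ∈ Jgamma k Q rel c, x * y = 0}

/-! ### The simple modules `S(v)`, and `Ext` groups -/

/-- the algebra map `A → k` corresponding to the vertex `v` (projection onto the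
coefficient of `ε_v`) -/
def vtxHomAux (v : Q.V) : FreeAlgebra k (Q.V ⊕ Q.Arr) →ₐ[k] k :=
  FreeAlgebra.lift k (Sum.elim (fun w => if w = v then (1 : k) else 0) (fun _ => 0))

theorem vtxHomAux_rel (v : Q.V) : ∀ ⦃x y⦄, GARel k Q rel x y →
    vtxHomAux k Q v x = vtxHomAux k Q v y := by
  intro x y h
  cases h with
  | idem w =>
      simp only [vtxHomAux, map_mul, FreeAlgebra.lift_ι_apply, Sum.elim_inl]
      split_ifs <;> simp
  | orth w w' hne =>
      simp only [vtxHomAux, map_mul, FreeAlgebra.lift_ι_apply, Sum.elim_inl, map_zero]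
      split_ifs with h1 h2 <;> first | (exact absurd (h1.trans h2.symm) hne) | simp
  | unit =>
      simp only [vtxHomAux, map_sum, FreeAlgebra.lift_ι_apply, Sum.elim_inl, map_one]
      simp [Finset.sum_ite_eq' Finset.univ v (fun _ => (1:k))]
  | src_mul a =>
      simp [vtxHomAux, map_mul, FreeAlgebra.lift_ι_apply]
  | mul_tgt a =>
      simp [vtxHomAux, map_mul, FreeAlgebra.lift_ι_apply]
  | src_zero w a hw =>
      simp [vtxHomAux, map_mul, FreeAlgebra.lift_ι_apply]
  | tgt_zero w a hw =>
      simp [vtxHomAux, map_mul, FreeAlgebra.lift_ι_apply]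
  | rel_zero a b hab =>
      simp [vtxHomAux, map_mul, FreeAlgebra.lift_ι_apply]

/-- the ring map `A → k` corresponding to the vertex `v` -/
def vtxHom (v : Q.V) : GA k Q rel →+* k :=
  RingQuot.lift ⟨(vtxHomAux k Q v).toRingHom, fun _ _ h => vtxHomAux_rel k Q rel v h⟩

/-- the ring map `A → k^{Q₀}` with kernel `A₊` -/
def SHom : GA k Q rel →+* (Q.V → k) := Pi.ringHom fun v => vtxHom k Q rel v

/-- the graded simple right `A`-module `S(v)` at the vertex `v` -/
def SvModR (v : Q.V) : ModuleCat (GA k Q rel)ᵐᵒᵖ :=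
  @ModuleCat.of _ _ k _
    (Module.compHom k ((vtxHom k Q rel v).fromOpposite (fun _ _ => mul_comm _ _)))

/-- the graded simple left `A`-module `S(v)` at the vertex `v` -/
def SvModL (v : Q.V) : ModuleCat (GA k Q rel) :=
  @ModuleCat.of _ _ k _ (Module.compHom k (vtxHom k Q rel v))

/-- `S = A/A₊ ≅ ⊕_v S(v)` as a right `A`-module -/
def SModR : ModuleCat (GA k Q rel)ᵐᵒᵖ :=
  @ModuleCat.of _ _ (Q.V → k) _
    (Module.compHom _ ((SHom k Q rel).fromOpposite (fun _ _ => mul_comm _ _)))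

/-- `S = A/A₊` as a left `A`-module -/
def SModL : ModuleCat (GA k Q rel) :=
  @ModuleCat.of _ _ (Q.V → k) _ (Module.compHom _ (SHom k Q rel))

/-- `A` as a right module over itself -/
def AModR : ModuleCat (GA k Q rel)ᵐᵒᵖ := ModuleCat.of _ (GA k Q rel)

/-- `A` as a left module over itself -/
def AModL : ModuleCat (GA k Q rel) := ModuleCat.of _ (GA k Q rel)

/-- nonvanishing of `Ext^i(M, N)` for modules over a ring `R` -/
def extNZ {R : Type} [Ring R] (i : ℕ) (M N : ModuleCat R) : Prop :=
  ¬ Subsingleton (((Ext ℤ (ModuleCat R) i).obj (Opposite.op M)).obj N)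

/-- nonvanishing of `Ext^i_A(S(v), A)` in right `A`-modules.  (For the Noetherian graded
algebra `A` with the finitely generated modules `S(v)` and `A` this agrees with the graded
`Ext`-group, summed over all shifts, used in the paper.) -/
def extSvNZ (i : ℕ) (v : Q.V) : Prop := extNZ i (SvModR k Q rel v) (AModR k Q rel)

/-- nonvanishing of `Ext^i_A(S, A)` in right `A`-modules -/
def extSNZ (i : ℕ) : Prop := extNZ i (SModR k Q rel) (AModR k Q rel)

/-- the depth of `A`: `min { i : Ext^i_A(S, A) ≠ 0 }` -/
def depth : ℕ∞ := sInf {n : ℕ∞ | ∃ i : ℕ, n = i ∧ extSNZ k Q rel i}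

/-- the right self-injective dimension of `A`:
`sup { i : Ext^i(M, A) ≠ 0 for some right module M }` -/
def rInjDim : ℕ∞ :=
  sSup {n : ℕ∞ | ∃ (i : ℕ) (M : ModuleCat.{0} (GA k Q rel)ᵐᵒᵖ), n = i ∧ extNZ i M (AModR k Q rel)}

/-- the left self-injective dimension of `A` -/
def lInjDim : ℕ∞ :=
  sSup {n : ℕ∞ | ∃ (i : ℕ) (M : ModuleCat.{0} (GA k Q rel)), n = i ∧ extNZ i M (AModL k Q rel)}

/-- the right global dimension of `A`: `sup { i : Ext^i(M, N) ≠ 0 }` over right modules -/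
def rGlDim : ℕ∞ :=
  sSup {n : ℕ∞ | ∃ (i : ℕ) (M N : ModuleCat.{0} (GA k Q rel)ᵐᵒᵖ), n = i ∧ extNZ i M N}

/-- the left global dimension of `A` -/
def lGlDim : ℕ∞ :=
  sSup {n : ℕ∞ | ∃ (i : ℕ) (M N : ModuleCat.{0} (GA k Q rel)), n = i ∧ extNZ i M N}

end LocGentle
namespace LocGentle

open scoped TensorProduct

set_option linter.unusedSectionVars false

section
variable {R : Type} [Ring R] (C : ChainComplex (ModuleCat.{0} R) ℕ) (M : ModuleCat.{0} R)
  (ε : C.X 0 ⟶ M)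

def projRes [∀ n, Projective (C.X n)] (hε : Function.Surjective ε)
    (w : C.d 1 0 ≫ ε = 0) (h0 : ∀ x, ε x = 0 → ∃ y, C.d 1 0 y = x)
    (h : ∀ n x, C.d (n + 1) n x = 0 → ∃ y, C.d (n + 2) (n + 1) y = x) :
    ProjectiveResolution M where
  complex := C
  π := (ChainComplex.toSingle₀Equiv _ _).symm ⟨ε, w⟩
  quasiIso := ⟨fun n => by
    obtain _ | n := n
    · rw [ChainComplex.quasiIsoAt₀_iff,
        ShortComplex.quasiIso_iff_of_zeros' _ (C.shape _ _ (by simp)) rfl rfl]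
      refine (ShortComplex.exact_and_epi_g_iff_of_iso
        (S₂ := ShortComplex.mk (C.d 1 0) ε w) ?_).2 ⟨?_, ?_⟩
      · exact ShortComplex.isoMk (Iso.refl _) (Iso.refl _) (Iso.refl _) (by simp; rfl) (by simp; rfl)
      · rw [ShortComplex.moduleCat_exact_iff]
        exact h0
      · rw [ModuleCat.epi_iff_surjective]
        exact hε
    · rw [quasiIsoAt_iff_exactAt']
      · rw [HomologicalComplex.exactAt_iff' _ (n + 2) (n + 1) n (by simp) (by simp),
          ShortComplex.moduleCat_exact_iff]
        exact h _
      · apply ChainComplex.exactAt_succ_single_obj⟩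

lemma subsingleton_ext_succ_iff' [∀ n, Projective (C.X n)] (hε : Function.Surjective ε)
    (w : C.d 1 0 ≫ ε = 0) (h0 : ∀ x, ε x = 0 → ∃ y, C.d 1 0 y = x)
    (h : ∀ n x, C.d (n + 1) n x = 0 → ∃ y, C.d (n + 2) (n + 1) y = x) (N : ModuleCat.{0} R) (n : ℕ) :
    Subsingleton (((Ext ℤ (ModuleCat R) (n + 1)).obj (Opposite.op M)).obj N) ↔
      ∀ f : C.X (n + 1) ⟶ N, C.d (n + 2) (n + 1) ≫ f = 0 → ∃ g : C.X n ⟶ N, C.d (n + 1) n ≫ g = f := by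
  let PR := projRes C M ε hε w h0 h
  rw [← ModuleCat.isZero_iff_subsingleton, (PR.isoExt (n + 1) N).isZero_iff,
    ← HomologicalComplex.exactAt_iff_isZero_homology, 
    HomologicalComplex.exactAt_iff' _ n (n + 1) (n + 2) (by simp) (by simp),
    ShortComplex.moduleCat_exact_iff]
  exact Iff.rfl
end

section
variable {R : Type} [Ring R] (P : ℕ → Type) [∀ n, AddCommGroup (P n)] [∀ n, Module R (P n)]
  (d : ∀ n, P (n + 1) →ₗ[R] P n) (hd : ∀ n, d n ∘ₗ d (n + 1) = 0)

def resComplex : ChainComplex (ModuleCat.{0} R) ℕ :=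
  ChainComplex.of (fun n => ModuleCat.of R (P n)) (fun n => ModuleCat.ofHom (d n))
    (fun n => by rw [← ModuleCat.ofHom_comp, hd]; rfl)

lemma resComplex_d (n : ℕ) : (resComplex P d hd).d (n + 1) n = ModuleCat.ofHom (d n) := by
  simp [resComplex]

lemma subsingleton_ext_succ_iff (M : ModuleCat.{0} R) (ε : P 0 →ₗ[R] M) [∀ n, Module.Projective R (P n)] (hε : Function.Surjective ε)
    (h0 : Function.Exact (d 0) ε) (h : ∀ n, Function.Exact (d (n + 1)) (d n)) (N : ModuleCat.{0} R) (n : ℕ) :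
    Subsingleton (((Ext ℤ (ModuleCat R) (n + 1)).obj (Opposite.op M)).obj N) ↔
      ∀ f : P (n + 1) →ₗ[R] N, f ∘ₗ d (n + 1) = 0 → ∃ g : P n →ₗ[R] N, g ∘ₗ d n = f := by
  have hd : ∀ n, d n ∘ₗ d (n + 1) = 0 := fun n => (h n).linearMap_comp_eq_zero
  let C := resComplex P d hd
  have : ∀ n, Projective (C.X n) := fun n =>
    inferInstanceAs (Projective (ModuleCat.of R (P n)))
  have hC (n) : C.d (n + 1) n = ModuleCat.ofHom (d n) := resComplex_d P d hd n
  have hC' (n x) : C.d (n + 1) n x = d n x := by rw [hC]; rfl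
  have w : C.d 1 0 ≫ ModuleCat.ofHom ε = 0 := by
    ext x
    exact (congrArg ε (hC' 0 x)).trans (h0.apply_apply_eq_zero x)
  rw [subsingleton_ext_succ_iff' C M (ModuleCat.ofHom ε) hε w ?_ ?_ N n]
  · constructor
    · intro H f hf
      obtain ⟨g, hg⟩ := H (ModuleCat.ofHom f) (by
        ext x
        exact (congrArg f (hC' (n + 1) x)).trans (LinearMap.congr_fun hf x))
      refine ⟨g.hom, ?_⟩
      ext x
      exact (congrArg g (hC' n x)).symm.trans (ConcreteCategory.congr_hom hg x)
    · intro H f hf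
      obtain ⟨g, hg⟩ := H f.hom (by
        ext x
        exact (congrArg f (hC' (n + 1) x)).symm.trans (ConcreteCategory.congr_hom hf x))
      refine ⟨ModuleCat.ofHom g, ?_⟩
      ext x
      exact (congrArg g (hC' n x)).trans (LinearMap.congr_fun hg x)
  · intro x hx
    obtain ⟨y, hy⟩ := (h0 x).1 hx
    exact ⟨y, (hC' 0 y).trans hy⟩
  · intro n x hx
    obtain ⟨y, hy⟩ := (h n x).1 ((hC' n x).symm.trans hx)
    exact ⟨y, (hC' (n + 1) y).trans hy⟩
end

/-- A `k`-algebra equipped with stationary paths, arrows and operators stripping the first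
(`ls`) or the last (`rs`) arrow off a path, satisfying the identities that hold in `kQ/I`. -/
structure PathStructure (k R : Type) [Field k] [Ring R] [Algebra k R] (Q : Quiv)
    (rel : Q.Arr → Q.Arr → Prop) where
  e : Q.V → R
  x : Q.Arr → R
  c : Q.V → R →ₐ[k] k
  ls : Q.Arr → R →ₗ[k] R
  rs : Q.Arr → R →ₗ[k] R
  e_mul_self (v) : e v * e v = e v
  e_mul_of_ne (v w) : v ≠ w → e v * e w = 0
  sum_e : ∑ v, e v = 1
  e_mul_x (a) : e (Q.src a) * x a = x a
  x_mul_e (a) : x a * e (Q.tgt a) = x a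
  x_mul_x (a b) : rel a b → x a * x b = 0
  c_e (v) : c v (e v) = 1
  c_x (v a) : c v (x a) = 0
  ls_e (a v) : ls a (e v) = 0
  ls_x_mul (a y) : ls a (x a * y) =
    e (Q.tgt a) * y - ∑ z, open Classical in if rel a z then x z * ls z y else 0
  ls_x_mul_of_ne (a b y) : a ≠ b → ls a (x b * y) = 0
  e_mul_ls (a y) : e (Q.tgt a) * ls a y = ls a y
  ls_ls (a b y) : rel a b ∨ Q.tgt a ≠ Q.src b → ls b (ls a y) = 0
  ls_e_mul (a y) : ls a (e (Q.src a) * y) = ls a y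
  ls_e_mul_of_ne (a v y) : v ≠ Q.src a → ls a (e v * y) = 0
  rs_e (a v) : rs a (e v) = 0
  rs_mul_x (a y) : rs a (y * x a) =
    y * e (Q.src a) - ∑ z, open Classical in if rel z a then rs z y * x z else 0
  rs_mul_x_of_ne (a b y) : a ≠ b → rs a (y * x b) = 0
  rs_mul_e (a y) : rs a y * e (Q.src a) = rs a y
  rs_rs (a b y) : rel b a ∨ Q.src a ≠ Q.tgt b → rs b (rs a y) = 0
  rs_e_mul (a y) : rs a (y * e (Q.tgt a)) = rs a y
  rs_e_mul_of_ne (a v y) : v ≠ Q.tgt a → rs a (y * e v) = 0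
  eq_top_of_mul_x (p : Submodule k R) : (∀ v, e v ∈ p) → (∀ y ∈ p, ∀ a, y * x a ∈ p) → p = ⊤
  eq_top_of_x_mul (p : Submodule k R) : (∀ v, e v ∈ p) → (∀ y ∈ p, ∀ a, x a * y ∈ p) → p = ⊤

namespace PathStructure

variable {k R : Type} [Field k] [Ring R] [Algebra k R] {Q : Quiv} {rel : Q.Arr → Q.Arr → Prop}
  (S : PathStructure k R Q rel)

/-- The elements annihilated by stripping `n` arrows on the right. -/
def filt : ℕ → Submodule k R
  | 0 => ⊥
  | n + 1 => ⨅ a, (filt n).comap (S.rs a)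

lemma mem_filt_succ {n : ℕ} {y : R} : y ∈ S.filt (n + 1) ↔ ∀ a, S.rs a y ∈ S.filt n := by
  simp [filt]

lemma filt_le_succ (n : ℕ) : S.filt n ≤ S.filt (n + 1) := by
  induction n with
  | zero => simp [filt]
  | succ n ih => exact fun y hy => S.mem_filt_succ.2 fun a => ih (S.mem_filt_succ.1 hy a)

lemma filt_mono : Monotone S.filt := monotone_nat_of_le_succ S.filt_le_succ

lemma mul_e_mem_filt {n : ℕ} {y : R} (hy : y ∈ S.filt n) (v : Q.V) : y * S.e v ∈ S.filt n := by
  cases n with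
  | zero => simp_all [filt]
  | succ n =>
    refine S.mem_filt_succ.2 fun a => ?_
    by_cases h : v = Q.tgt a
    · subst h; rw [S.rs_e_mul]; exact S.mem_filt_succ.1 hy a
    · rw [S.rs_e_mul_of_ne _ _ _ h]; exact zero_mem _

lemma mul_x_mem_filt {n : ℕ} {y : R} (hy : y ∈ S.filt n) (b : Q.Arr) :
    y * S.x b ∈ S.filt (n + 1) := by
  induction n generalizing y b with
  | zero =>
    obtain rfl : y = 0 := by simpa [filt] using hy
    simp
  | succ n ih =>
    refine S.mem_filt_succ.2 fun a => ?_
    by_cases h : a = b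
    · subst h
      rw [S.rs_mul_x]
      refine sub_mem (S.mul_e_mem_filt hy _) (sum_mem fun z _ => ?_)
      split_ifs
      · exact ih (S.mem_filt_succ.1 hy z) z
      · exact zero_mem _
    · rw [S.rs_mul_x_of_ne _ _ _ h]; exact zero_mem _

lemma exists_mem_filt (y : R) : ∃ n, y ∈ S.filt n := by
  have hdir : Directed (· ≤ ·) S.filt := S.filt_mono.directed_le
  have := S.eq_top_of_mul_x (⨆ n, S.filt n)
    (fun v => Submodule.mem_iSup_of_mem 1 (S.mem_filt_succ.2 fun a => by rw [S.rs_e]; exact zero_mem _))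
    (fun y hy a => by
      obtain ⟨n, hn⟩ := (Submodule.mem_iSup_of_directed _ hdir).1 hy
      exact Submodule.mem_iSup_of_mem (n + 1) (S.mul_x_mem_filt hn a))
  exact (Submodule.mem_iSup_of_directed _ hdir).1 (this ▸ Submodule.mem_top)

variable (M : Type) [AddCommGroup M] [Module k M] [Module R M] [IsScalarTower k R M]

/-- The ambient module of the Koszul resolution: a copy of `R ⊗ M` for each word. -/
def Amb (_ : PathStructure k R Q rel) : Type := List Q.Arr →₀ (R ⊗[k] M)

instance : AddCommGroup (S.Amb M) := inferInstanceAs (AddCommGroup (List Q.Arr →₀ (R ⊗[k] M)))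

instance : Module R (S.Amb M) := inferInstanceAs (Module R (List Q.Arr →₀ (R ⊗[k] M)))

instance : Module.Projective R (S.Amb M) :=
  inferInstanceAs (Module.Projective R (List Q.Arr →₀ (R ⊗[k] M)))

variable {M}

/-- The inclusion of the summand of a word. -/
def sg (l : List Q.Arr) : R ⊗[k] M →ₗ[R] S.Amb M := Finsupp.lsingle l

/-- The linear map with given restrictions to the summands. -/
def liftL {N : Type} [AddCommGroup N] [Module R N] (f : List Q.Arr → (R ⊗[k] M →ₗ[R] N)) :
    S.Amb M →ₗ[R] N := Finsupp.lsum ℕ f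

/-- The additive map with given restrictions to the summands. -/
def liftA {N : Type} [AddCommGroup N] (f : List Q.Arr → (R ⊗[k] M →+ N)) :
    S.Amb M →+ N := Finsupp.liftAddHom f

@[simp] lemma liftL_sg {N : Type} [AddCommGroup N] [Module R N]
    (f : List Q.Arr → (R ⊗[k] M →ₗ[R] N)) (l : List Q.Arr) (t : R ⊗[k] M) :
    S.liftL f (S.sg l t) = f l t := Finsupp.lsum_single ℕ f l t

@[simp] lemma liftA_sg {N : Type} [AddCommGroup N]
    (f : List Q.Arr → (R ⊗[k] M →+ N)) (l : List Q.Arr) (t : R ⊗[k] M) :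
    S.liftA f (S.sg l t) = f l t := Finsupp.liftAddHom_apply_single f l t

lemma amb_induction {p : S.Amb M → Prop} (y : S.Amb M) (zero : p 0)
    (add : ∀ y z, p y → p z → p (y + z))
    (sg : ∀ l (y : R) (m : M), p (S.sg l (y ⊗ₜ[k] m))) : p y := by
  refine Finsupp.induction_linear (motive := p) y zero add fun l t => ?_
  change p (S.sg l t)
  induction t using TensorProduct.induction_on with
  | zero => rw [map_zero]; exact zero
  | add s t hs ht => rw [map_add]; exact add _ _ hs ht
  | tmul y m => exact sg l y m

/-- The map `y ⊗ m ↦ y r ⊗ s m`. -/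
def tm (_ : PathStructure k R Q rel) (r s : R) : R ⊗[k] M →ₗ[R] R ⊗[k] M :=
  TensorProduct.AlgebraTensorModule.map (LinearMap.toSpanSingleton R R r) (Algebra.lsmul k k M s)

@[simp] lemma tm_tmul (r s y : R) (m : M) : S.tm r s (y ⊗ₜ[k] m) = (y * r) ⊗ₜ[k] (s • m) := rfl

/-- `v` and `u` are the source and the target of the word `l`. -/
def Ends (l : List Q.Arr) (v u : Q.V) : Prop :=
  match l with
  | [] => v = u
  | a :: w => v = Q.src a ∧ u = Q.tgt ((a :: w).getLast (by simp))

/-- The projection of `R ⊗ M` cut out by the idempotents at the two ends of a word. -/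
def pr : List Q.Arr → (R ⊗[k] M →ₗ[R] R ⊗[k] M)
  | [] => ∑ v, S.tm (S.e v) (S.e v)
  | a :: w => S.tm (S.e (Q.src a)) (S.e (Q.tgt ((a :: w).getLast (by simp))))

open Classical in
/-- The projection onto the `n`-th term of the Koszul resolution. -/
def proj (n : ℕ) : S.Amb M →ₗ[R] S.Amb M :=
  S.liftL fun l =>
    if l.IsChain rel ∧ l.length = n then S.sg l ∘ₗ S.pr l else 0

/-- The Koszul differential. -/
def diff : S.Amb M →ₗ[R] S.Amb M :=
  S.liftL fun l =>
    match l with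
    | [] => 0
    | a :: w => S.sg w ∘ₗ S.tm (S.x a) 1 +
      (-1 : ℤ) ^ (w.length + 1) • S.sg (a :: w).dropLast ∘ₗ
        S.tm 1 (S.x ((a :: w).getLast (by simp)))

lemma proj_single {n : ℕ} {l : List Q.Arr} (hl : l.IsChain rel) (hn : l.length = n) (t : R ⊗[k] M) :
    S.proj n (S.sg l t) = S.sg l (S.pr l t) := by
  simp [proj, hl, hn]

lemma proj_single_of_not {n : ℕ} {l : List Q.Arr} (hl : ¬ (l.IsChain rel ∧ l.length = n))
    (t : R ⊗[k] M) : S.proj n (S.sg l t) = 0 := by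
  simp only [proj, liftL_sg, if_neg hl, LinearMap.zero_apply]

lemma diff_single_cons (a : Q.Arr) (w : List Q.Arr) (y : R) (m : M) :
    S.diff (S.sg (a :: w) (y ⊗ₜ[k] m)) = S.sg w ((y * S.x a) ⊗ₜ[k] m) +
      (-1 : ℤ) ^ (w.length + 1) • S.sg (a :: w).dropLast
        (y ⊗ₜ[k] (S.x ((a :: w).getLast (by simp)) • m)) := by
  simp [diff]

/-- `y ⊗ m` lies in the part of `R ⊗ M` cut out by the ends of `l`. -/
structure Fits (l : List Q.Arr) (y : R) (m : M) : Prop where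
  ex : ∃ v u, Ends l v u ∧ y * S.e v = y ∧ S.e u • m = m

variable {S}

lemma fits_nil {v : Q.V} {y : R} {m : M} (hy : y * S.e v = y) (hm : S.e v • m = m) :
    S.Fits [] y m := ⟨v, v, rfl, hy, hm⟩

lemma fits_cons {a : Q.Arr} {w : List Q.Arr} {y : R} {m : M} :
    S.Fits (a :: w) y m ↔ y * S.e (Q.src a) = y ∧
      S.e (Q.tgt ((a :: w).getLast (by simp))) • m = m := by
  constructor
  · rintro ⟨_, _, ⟨rfl, rfl⟩, h⟩
    exact h
  · rintro h
    exact ⟨_, _, ⟨rfl, rfl⟩, h⟩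

lemma Fits.pr_tmul {l : List Q.Arr} {y : R} {m : M} (h : S.Fits l y m) :
    S.pr l (y ⊗ₜ[k] m) = y ⊗ₜ[k] m := by
  cases l with
  | nil =>
    obtain ⟨v, u, h1, hy, hm⟩ := h
    obtain rfl : v = u := h1
    simp only [pr, LinearMap.sum_apply, tm_tmul]
    rw [Finset.sum_eq_single v, hy, hm]
    · intro w _ hw
      rw [← hy, mul_assoc, S.e_mul_of_ne _ _ hw.symm]
      simp
    · simp
  | cons a w =>
    rw [fits_cons] at h
    simp only [pr, tm_tmul, h.1, h.2]

lemma Fits.proj_single {n : ℕ} {l : List Q.Arr} {y : R} {m : M} (h : S.Fits l y m)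
    (hl : l.IsChain rel) (hn : l.length = n) :
    S.proj n (S.sg l (y ⊗ₜ[k] m)) = S.sg l (y ⊗ₜ[k] m) := by
  rw [S.proj_single hl hn, h.pr_tmul]

variable (S)

lemma pr_tmul_mem (l : List Q.Arr) (y : R) (m : M) (T : AddSubgroup (R ⊗[k] M))
    (h : ∀ v u, Ends l v u → (y * S.e v) ⊗ₜ[k] (S.e u • m) ∈ T) : S.pr l (y ⊗ₜ[k] m) ∈ T := by
  cases l with
  | nil =>
    simp only [pr, LinearMap.sum_apply, tm_tmul]
    exact sum_mem fun v _ => h v v rfl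
  | cons a w => exact h _ _ ⟨rfl, rfl⟩

lemma fits_ends {l : List Q.Arr} {v u : Q.V} (h : Ends l v u) (y : R) (m : M) :
    S.Fits l (y * S.e v) (S.e u • m) :=
  ⟨v, u, h, by rw [mul_assoc, S.e_mul_self], by rw [← mul_smul, S.e_mul_self]⟩

/-- Two additive maps agree on the `n`-th term of the Koszul resolution if they agree on its
generators. -/
lemma proj_hom_ext {N : Type} [AddCommGroup N] (n : ℕ) (f g : S.Amb M →+ N)
    (h : ∀ l : List Q.Arr, l.IsChain rel → l.length = n → ∀ (y : R) (m : M), S.Fits l y m →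
      f (S.sg l (y ⊗ₜ[k] m)) = g (S.sg l (y ⊗ₜ[k] m))) (y : S.Amb M) :
    f (S.proj n y) = g (S.proj n y) := by
  refine S.amb_induction (p := fun y => f (S.proj n y) = g (S.proj n y)) y (by simp)
    (fun p q hp hq => by simp [hp, hq]) fun l y m => ?_
  by_cases hl : l.IsChain rel ∧ l.length = n
  · rw [S.proj_single hl.1 hl.2]
    refine S.pr_tmul_mem l y m
      ((f.comp (S.sg l).toAddMonoidHom).eqLocus (g.comp (S.sg l).toAddMonoidHom)) ?_
    intro v u hvu
    exact h l hl.1 hl.2 _ _ (S.fits_ends hvu y m)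
  · rw [S.proj_single_of_not hl]; simp

lemma proj_proj (n : ℕ) (y : S.Amb M) : S.proj n (S.proj n y) = S.proj n y := by
  have := S.proj_hom_ext n (S.proj (M := M) n).toAddMonoidHom (LinearMap.id (R := R) (M := S.Amb M)).toAddMonoidHom ?_ y
  · exact this
  · intro _ hl hn _ _ h
    exact h.proj_single hl hn

end PathStructure

namespace PathStructure

variable {k R : Type} [Field k] [Ring R] [Algebra k R] {Q : Quiv} {rel : Q.Arr → Q.Arr → Prop}
  (S : PathStructure k R Q rel) {M : Type} [AddCommGroup M] [Module k M] [Module R M]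
  [IsScalarTower k R M]

lemma diff_single_singleton (a : Q.Arr) (y : R) (m : M) :
    S.diff (S.sg [a] (y ⊗ₜ[k] m)) =
      S.sg [] ((y * S.x a) ⊗ₜ[k] m) - S.sg [] (y ⊗ₜ[k] (S.x a • m)) := by
  rw [diff_single_cons]
  simp [sub_eq_add_neg]

lemma diff_single_cons_concat (a b : Q.Arr) (u : List Q.Arr) (y : R) (m : M) :
    S.diff (S.sg (a :: (u ++ [b])) (y ⊗ₜ[k] m)) =
      S.sg (u ++ [b]) ((y * S.x a) ⊗ₜ[k] m) +
        (-1 : ℤ) ^ u.length • S.sg (a :: u) (y ⊗ₜ[k] (S.x b • m)) := by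
  rw [diff_single_cons]
  have h1 : (a :: (u ++ [b])).dropLast = a :: u := by
    rw [← List.cons_append, List.dropLast_concat]
  have h2 : (a :: (u ++ [b])).getLast (by simp) = b := by simp
  rw [h1, h2]
  simp [pow_succ]

lemma list_cases (l : List Q.Arr) : l = [] ∨ (∃ a, l = [a]) ∨ ∃ a u b, l = a :: (u ++ [b]) := by
  cases l with
  | nil => exact Or.inl rfl
  | cons a w =>
    rcases List.eq_nil_or_concat w with rfl | ⟨u, b, rfl⟩
    · exact Or.inr (Or.inl ⟨a, rfl⟩)
    · exact Or.inr (Or.inr ⟨a, u, b, by simp⟩)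

lemma isChain_left {a b : Q.Arr} {u : List Q.Arr} (h : (a :: (u ++ [b])).IsChain rel) :
    (a :: u).IsChain rel := by
  rw [← List.cons_append] at h
  exact h.left_of_append

variable {S}

lemma fits_cons_concat {a b : Q.Arr} {u : List Q.Arr} {y : R} {m : M} :
    S.Fits (a :: (u ++ [b])) y m ↔ y * S.e (Q.src a) = y ∧ S.e (Q.tgt b) • m = m := by
  rw [fits_cons]
  simp

lemma fits_tail (hc : ∀ a b, rel a b → Q.tgt a = Q.src b) {a : Q.Arr} {w : List Q.Arr}
    (hl : (a :: w).IsChain rel) {y : R} {m : M} (h : S.Fits (a :: w) y m) :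
    S.Fits w (y * S.x a) m := by
  rw [fits_cons] at h
  cases w with
  | nil => exact fits_nil (v := Q.tgt a) (by rw [mul_assoc, S.x_mul_e]) (by simpa using h.2)
  | cons c w =>
    rw [fits_cons]
    have h1 := hc _ _ (List.isChain_cons_cons.1 hl).1
    exact ⟨by rw [← h1, mul_assoc, S.x_mul_e], by simpa using h.2⟩

lemma fits_init (hc : ∀ a b, rel a b → Q.tgt a = Q.src b) {a b : Q.Arr} {u : List Q.Arr}
    (hl : (a :: (u ++ [b])).IsChain rel) {y : R} {m : M} (h : S.Fits (a :: (u ++ [b])) y m) :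
    S.Fits (a :: u) y (S.x b • m) := by
  rw [fits_cons_concat] at h
  rw [fits_cons]
  refine ⟨h.1, ?_⟩
  have : rel ((a :: u).getLast (by simp)) b := by
    rw [← List.cons_append] at hl
    have := List.isChain_append.1 hl
    exact this.2.2 _ (List.getLast?_eq_getLast_of_ne_nil (by simp)) b (by simp)
  rw [hc _ _ this, ← mul_smul, S.e_mul_x]

variable (S)

lemma proj_diff_proj (hc : ∀ a b, rel a b → Q.tgt a = Q.src b) (n : ℕ) (y : S.Amb M) :
    S.proj n (S.diff (S.proj (n + 1) y)) = S.diff (S.proj (n + 1) y) := by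
  have := S.proj_hom_ext (n + 1) ((S.proj (M := M) n) ∘ₗ S.diff).toAddMonoidHom
    (S.diff (M := M)).toAddMonoidHom ?_ y
  · exact this
  intro l hl hn y m h
  simp only [LinearMap.toAddMonoidHom_coe, LinearMap.coe_comp, Function.comp_apply]
  rcases list_cases l with rfl | ⟨a, rfl⟩ | ⟨a, u, b, rfl⟩
  · simp at hn
  · obtain rfl : n = 0 := by simpa using hn.symm
    rw [fits_cons] at h
    rw [diff_single_singleton, map_sub, Fits.proj_single, Fits.proj_single]
    · exact fits_nil h.1 (by rw [← mul_smul, S.e_mul_x])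
    · simp
    · simp
    · exact fits_nil (v := Q.tgt a) (by rw [mul_assoc, S.x_mul_e]) (by simpa using h.2)
    · simp
    · simp
  · have hn' : u.length + 1 = n := by simpa using hn
    rw [diff_single_cons_concat, map_add, map_zsmul, Fits.proj_single (fits_tail hc hl h) hl.tail
      (by simpa using hn'), Fits.proj_single (fits_init hc hl h) (isChain_left hl)
      (by simpa using hn')]

lemma diff_diff_proj (n : ℕ) (y : S.Amb M) : S.diff (S.diff (S.proj (n + 2) y)) = 0 := by
  have := S.proj_hom_ext (n + 2) ((S.diff (M := M)) ∘ₗ S.diff).toAddMonoidHom 0 ?_ y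
  · exact this
  intro l hl hn y m _
  simp only [LinearMap.toAddMonoidHom_coe, LinearMap.coe_comp, Function.comp_apply,
    AddMonoidHom.zero_apply]
  rcases list_cases l with rfl | ⟨a, rfl⟩ | ⟨a, u, b, rfl⟩
  · simp at hn
  · simp at hn
  have h1 : S.diff (S.sg (u ++ [b]) ((y * S.x a) ⊗ₜ[k] m)) =
      (-1 : ℤ) ^ (u.length + 1) • S.sg u ((y * S.x a) ⊗ₜ[k] (S.x b • m)) := by
    cases u with
    | nil =>
      have : rel a b := by simpa using hl
      simp only [List.nil_append]
      rw [diff_single_singleton, mul_assoc, S.x_mul_x _ _ this]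
      simp
    | cons c u =>
      have : rel a c := (List.isChain_cons_cons.1 hl).1
      rw [List.cons_append, diff_single_cons_concat, mul_assoc, S.x_mul_x _ _ this]
      simp [pow_succ]
  have h2 : S.diff (S.sg (a :: u) (y ⊗ₜ[k] (S.x b • m))) =
      S.sg u ((y * S.x a) ⊗ₜ[k] (S.x b • m)) := by
    rcases List.eq_nil_or_concat u with rfl | ⟨u, c, rfl⟩
    · have : rel a b := by simpa using hl
      rw [diff_single_singleton, ← mul_smul, S.x_mul_x _ _ this]
      simp
    · have : rel c b := by
        have h := hl.tail
        simp only [List.concat_eq_append, List.tail_cons, List.append_assoc] at h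
        exact (List.isChain_cons_cons.1 h.right_of_append).1
      rw [List.concat_eq_append, diff_single_cons_concat, ← mul_smul, S.x_mul_x _ _ this]
      simp
  rw [diff_single_cons_concat, map_add, map_zsmul, h1, h2]
  simp [pow_succ]

/-- The augmentation of the Koszul resolution. -/
def aug : S.Amb M →ₗ[R] M := S.liftL fun l =>
  if l = [] then TensorProduct.AlgebraTensorModule.lift
    ((LinearMap.toSpanSingleton R (M →ₗ[k] M) LinearMap.id)) else 0

@[simp] lemma aug_nil (y : R) (m : M) : S.aug (S.sg [] (y ⊗ₜ[k] m)) = y • m := by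
  simp [aug]

end PathStructure

namespace PathStructure

variable {k R : Type} [Field k] [Ring R] [Algebra k R] {Q : Quiv} {rel : Q.Arr → Q.Arr → Prop}
  (S : PathStructure k R Q rel) {M : Type} [AddCommGroup M] [Module k M] [Module R M]
  [IsScalarTower k R M]

lemma aug_diff_proj (y : S.Amb M) : S.aug (S.diff (S.proj 1 y)) = 0 := by
  have := S.proj_hom_ext 1 ((S.aug (M := M)) ∘ₗ S.diff).toAddMonoidHom 0 ?_ y
  · exact this
  intro l hl hn y m _
  obtain ⟨a, rfl⟩ := List.length_eq_one_iff.1 hn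
  simp only [LinearMap.toAddMonoidHom_coe, LinearMap.coe_comp, Function.comp_apply,
    AddMonoidHom.zero_apply]
  rw [diff_single_singleton, map_sub, aug_nil, aug_nil, mul_smul, sub_self]

/-- An additive section of the augmentation. -/
def incl : M →+ S.Amb M where
  toFun m := ∑ v, S.sg [] (S.e v ⊗ₜ[k] (S.e v • m))
  map_zero' := by simp
  map_add' m m' := by simp [TensorProduct.tmul_add, Finset.sum_add_distrib]

lemma incl_apply (m : M) : S.incl m = ∑ v, S.sg [] (S.e v ⊗ₜ[k] (S.e v • m)) := rfl

lemma proj_incl (m : M) : S.proj 0 (S.incl m) = S.incl m := by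
  rw [incl_apply, map_sum]
  refine Finset.sum_congr rfl fun v _ => ?_
  exact Fits.proj_single (fits_nil (v := v) (S.e_mul_self v) (by rw [← mul_smul, S.e_mul_self]))
    (by simp) rfl

lemma aug_incl (m : M) : S.aug (S.incl m) = m := by
  simp only [incl_apply, map_sum, aug_nil, ← mul_smul, S.e_mul_self]
  rw [← Finset.sum_smul, S.sum_e, one_smul]

lemma proj_zero_nil (y : R) (m : M) : S.proj 0 (S.sg [] (y ⊗ₜ[k] m)) =
    ∑ v, S.sg [] ((y * S.e v) ⊗ₜ[k] (S.e v • m)) := by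
  rw [S.proj_single (n := 0) (l := []) (by simp) rfl]
  simp only [pr, LinearMap.sum_apply, tm_tmul, map_sum]

lemma proj_zero_e (v : Q.V) (m : M) :
    S.proj 0 (S.sg [] (S.e v ⊗ₜ[k] m)) = S.incl (S.e v • m) := by
  rw [proj_zero_nil, incl_apply]
  refine Finset.sum_congr rfl fun w _ => ?_
  by_cases hw : v = w
  · subst hw; rw [S.e_mul_self, ← mul_smul, S.e_mul_self]
  · rw [S.e_mul_of_ne _ _ hw, ← mul_smul, S.e_mul_of_ne _ _ (Ne.symm hw)]
    simp

lemma proj_zero_mul_x (y : R) (a : Q.Arr) (m : M) : S.proj 0 (S.sg [] ((y * S.x a) ⊗ₜ[k] m)) =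
    S.diff (S.proj 1 (S.sg [a] (y ⊗ₜ[k] m))) + S.proj 0 (S.sg [] (y ⊗ₜ[k] (S.x a • m))) := by
  rw [proj_zero_nil, proj_zero_nil, S.proj_single (n := 1) (l := [a]) (by simp) rfl]
  simp only [pr, tm_tmul]
  rw [diff_single_singleton, Finset.sum_eq_single (Q.tgt a), Finset.sum_eq_single (Q.src a)]
  · simp only [List.getLast_singleton]
    rw [mul_assoc, mul_assoc, S.x_mul_e, S.e_mul_x, ← mul_smul, ← mul_smul, S.e_mul_x,
      S.x_mul_e]
    abel
  · intro v _ hv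
    rw [← mul_smul, ← S.e_mul_x a, ← mul_assoc, S.e_mul_of_ne _ _ hv]
    simp
  · simp
  · intro v _ hv
    rw [mul_assoc, ← S.x_mul_e a, mul_assoc, S.e_mul_of_ne _ _ hv.symm]
    simp
  · simp

lemma proj_zero_mem (T : AddSubgroup (S.Amb M)) (h1 : ∀ m, S.incl m ∈ T)
    (h2 : ∀ z, S.diff (S.proj 1 z) ∈ T) (y : R) (m : M) :
    S.proj 0 (S.sg [] (y ⊗ₜ[k] m)) ∈ T := by
  have hp := S.eq_top_of_mul_x
    { carrier := {y | ∀ m, S.proj 0 (S.sg [] (y ⊗ₜ[k] m)) ∈ T}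
      add_mem' := fun ha hb m => by
        rw [TensorProduct.add_tmul, map_add, map_add]; exact T.add_mem (ha m) (hb m)
      zero_mem' := fun m => by simp [T.zero_mem]
      smul_mem' := fun r y hy m => by
        rw [TensorProduct.smul_tmul]; exact hy _ }
    (fun v m => by rw [proj_zero_e]; exact h1 _)
    (fun y hy a m => by rw [proj_zero_mul_x]; exact T.add_mem (h2 _) (hy _))
  exact (Submodule.eq_top_iff'.1 hp y) m

lemma exists_of_proj_zero (y : S.Amb M) :
    ∃ z m, S.proj 0 y = S.diff (S.proj 1 z) + S.incl m := by
  let T : AddSubgroup (S.Amb M) :=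
    (S.diff ∘ₗ S.proj (M := M) 1).toAddMonoidHom.range ⊔ S.incl.range
  suffices h : S.proj 0 y ∈ T by
    obtain ⟨_, ⟨z, rfl⟩, _, ⟨m, rfl⟩, h⟩ := AddSubgroup.mem_sup.1 h
    exact ⟨z, m, h.symm⟩
  refine S.amb_induction (p := fun y => S.proj 0 y ∈ T) y (by simp [T.zero_mem])
    (fun p q hp hq => by rw [map_add]; exact T.add_mem hp hq) fun l y m => ?_
  by_cases hl : l = []
  · subst hl
    exact S.proj_zero_mem T (fun m => AddSubgroup.mem_sup_right ⟨m, rfl⟩)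
      (fun z => AddSubgroup.mem_sup_left ⟨z, rfl⟩) y m
  · rw [proj_single_of_not _ (by simpa using fun _ => hl)]
    exact T.zero_mem

lemma exact_zero (y : S.Amb M)
    (h : S.aug (S.proj 0 y) = 0) : ∃ z, S.diff (S.proj 1 z) = S.proj 0 y := by
  obtain ⟨z, m, hy⟩ := S.exists_of_proj_zero y
  rw [hy, map_add, aug_diff_proj, aug_incl, zero_add] at h
  exact ⟨z, by rw [hy, h, map_zero, add_zero]⟩

/-- The filtration of the Koszul resolution by the length of the first tensor factor. -/
def Fil (j : ℕ) : AddSubgroup (S.Amb M) :=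
  AddSubgroup.closure {z | ∃ l y, ∃ m : M, y ∈ S.filt j ∧ z = S.sg l (y ⊗ₜ[k] m)}

lemma sg_mem_Fil {j : ℕ} (l : List Q.Arr) {y : R} (m : M) (hy : y ∈ S.filt j) :
    S.sg l (y ⊗ₜ[k] m) ∈ S.Fil j := AddSubgroup.subset_closure ⟨l, y, m, hy, rfl⟩

lemma Fil_mono : Monotone (S.Fil (M := M)) := by
  intro i j hij
  refine (AddSubgroup.closure_le _).2 ?_
  rintro _ ⟨l, y, m, hy, rfl⟩
  exact S.sg_mem_Fil l m (S.filt_mono hij hy)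

lemma exists_mem_Fil (y : S.Amb M) : ∃ j, y ∈ S.Fil j := by
  refine S.amb_induction (p := fun y => ∃ j, y ∈ S.Fil j) y ⟨0, zero_mem _⟩ ?_ ?_
  · rintro y z ⟨i, hi⟩ ⟨j, hj⟩
    exact ⟨max i j, add_mem (S.Fil_mono (le_max_left _ _) hi) (S.Fil_mono (le_max_right _ _) hj)⟩
  · intro l y m
    obtain ⟨j, hj⟩ := S.exists_mem_filt y
    exact ⟨j, S.sg_mem_Fil l m hj⟩

open Classical in
/-- The contracting homotopy up to smaller filtration. -/
def hty : S.Amb M →+ S.Amb M := S.liftA fun l =>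
  ∑ z, if (z :: l).IsChain rel then (S.sg (z :: l)).toAddMonoidHom.comp
    (LinearMap.rTensor M (S.rs z)).toAddMonoidHom else 0

open Classical in
lemma hty_sg (l : List Q.Arr) (y : R) (m : M) : S.hty (S.sg l (y ⊗ₜ[k] m)) =
    ∑ z, if (z :: l).IsChain rel then S.sg (z :: l) (S.rs z y ⊗ₜ[k] m) else 0 := by
  simp only [hty, liftA_sg, AddMonoidHom.finsetSum_apply]
  refine Finset.sum_congr rfl fun z _ => ?_
  split_ifs <;> simp

lemma proj_hty_proj {n : ℕ} (hn : n ≠ 0) (y : S.Amb M) :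
    S.proj (n + 1) (S.hty (S.proj n y)) = S.hty (S.proj n y) := by
  have := S.proj_hom_ext n ((S.proj (M := M) (n + 1)).toAddMonoidHom.comp S.hty) S.hty ?_ y
  · exact this
  intro l hl hln y m h
  simp only [AddMonoidHom.comp_apply, hty_sg, map_sum, LinearMap.toAddMonoidHom_coe]
  refine Finset.sum_congr rfl fun z _ => ?_
  split_ifs with hz
  · refine Fits.proj_single (fits_cons.2 ⟨S.rs_mul_e z y, ?_⟩) hz (by simp [hln])
    cases l with
    | nil => exact absurd hln.symm hn
    | cons a w => simpa using (fits_cons.1 h).2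
  · simp

end PathStructure

namespace PathStructure

variable {k R : Type} [Field k] [Ring R] [Algebra k R] {Q : Quiv} {rel : Q.Arr → Q.Arr → Prop}
  (S : PathStructure k R Q rel) {M : Type} [AddCommGroup M] [Module k M] [Module R M]
  [IsScalarTower k R M]

open Classical in
lemma sg_rs_mul_x (l : List Q.Arr) {a : Q.Arr} {y : R} (m : M) (hy : y * S.e (Q.src a) = y) :
    S.sg l (S.rs a (y * S.x a) ⊗ₜ[k] m) =
      S.sg l (y ⊗ₜ[k] m) - ∑ z, if rel z a then S.sg l ((S.rs z y * S.x z) ⊗ₜ[k] m) else 0 := by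
  let f : R →+ S.Amb M := (S.sg l).toAddMonoidHom.comp
    ((TensorProduct.mk k R M).flip m).toAddMonoidHom
  change f _ = f _ - ∑ z, if rel z a then f _ else 0
  rw [S.rs_mul_x, hy, map_sub, map_sum]
  congr 1
  exact Finset.sum_congr rfl fun z _ => by split_ifs <;> simp

open Classical in
lemma hty_sg_mul_x {a : Q.Arr} {w : List Q.Arr} (hl : (a :: w).IsChain rel) (y : R) (m : M) :
    S.hty (S.sg w ((y * S.x a) ⊗ₜ[k] m)) = S.sg (a :: w) (S.rs a (y * S.x a) ⊗ₜ[k] m) := by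
  rw [hty_sg, Finset.sum_eq_single a, if_pos hl]
  · intro z _ hz
    rw [S.rs_mul_x_of_ne _ _ _ hz]
    simp
  · simp

lemma hty_spec_singleton {j : ℕ} {a : Q.Arr} {y : R} (m : M)
    (hy : y * S.e (Q.src a) = y) (hj : y ∈ S.filt (j + 1)) :
    S.sg [a] (y ⊗ₜ[k] m) - S.diff (S.hty (S.sg [a] (y ⊗ₜ[k] m))) -
      S.hty (S.diff (S.sg [a] (y ⊗ₜ[k] m))) ∈ S.Fil j := by
  classical
  rw [diff_single_singleton, map_sub, S.hty_sg_mul_x (by simp), S.sg_rs_mul_x _ m hy, hty_sg, hty_sg]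
  have h1 : S.diff (∑ z, if (z :: [a]).IsChain rel then
      S.sg (z :: [a]) (S.rs z y ⊗ₜ[k] m) else 0) =
      (∑ z, if rel z a then S.sg [a] ((S.rs z y * S.x z) ⊗ₜ[k] m) else 0) +
      ∑ z, if rel z a then S.sg [z] (S.rs z y ⊗ₜ[k] (S.x a • m)) else 0 := by
    rw [map_sum, ← Finset.sum_add_distrib]
    refine Finset.sum_congr rfl fun z _ => ?_
    by_cases hz : rel z a
    · have := S.diff_single_cons_concat z a [] (S.rs z y) m
      simp only [List.nil_append, List.length_nil, pow_zero, one_smul] at this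
      simp [hz, this]
    · simp [hz]
  rw [h1]
  have h2 : ∀ z, S.sg [z] (S.rs z y ⊗ₜ[k] (S.x a • m)) ∈ S.Fil (M := M) j := fun z =>
    S.sg_mem_Fil _ _ (S.mem_filt_succ.1 hj z)
  have h3 : (∑ z, if [z].IsChain rel then S.sg [z] (S.rs z y ⊗ₜ[k] (S.x a • m)) else 0) -
      (∑ z, if rel z a then S.sg [z] (S.rs z y ⊗ₜ[k] (S.x a • m)) else 0) ∈ S.Fil (M := M) j := by
    refine sub_mem (sum_mem fun z _ => ?_) (sum_mem fun z _ => ?_)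
    · split_ifs
      exacts [h2 z, zero_mem _]
    · split_ifs
      exacts [h2 z, zero_mem _]
  convert h3 using 1
  abel

lemma hty_spec_concat {a b : Q.Arr} {u : List Q.Arr} (hl : (a :: (u ++ [b])).IsChain rel)
    {y : R} (m : M) (hy : y * S.e (Q.src a) = y) :
    S.sg (a :: (u ++ [b])) (y ⊗ₜ[k] m) - S.diff (S.hty (S.sg (a :: (u ++ [b])) (y ⊗ₜ[k] m))) -
      S.hty (S.diff (S.sg (a :: (u ++ [b])) (y ⊗ₜ[k] m))) = 0 := by
  classical
  rw [diff_single_cons_concat, map_add, S.hty_sg_mul_x hl, S.sg_rs_mul_x _ m hy, hty_sg,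
    map_zsmul, hty_sg]
  have h1 : S.diff (∑ z, if (z :: a :: (u ++ [b])).IsChain rel then
      S.sg (z :: a :: (u ++ [b])) (S.rs z y ⊗ₜ[k] m) else 0) =
      (∑ z, if rel z a then S.sg (a :: (u ++ [b])) ((S.rs z y * S.x z) ⊗ₜ[k] m) else 0) -
      (-1 : ℤ) ^ u.length • ∑ z, if (z :: a :: u).IsChain rel then
        S.sg (z :: a :: u) (S.rs z y ⊗ₜ[k] (S.x b • m)) else 0 := by
    rw [map_sum, Finset.smul_sum, ← Finset.sum_sub_distrib]
    refine Finset.sum_congr rfl fun z _ => ?_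
    by_cases hz : rel z a
    · have := S.diff_single_cons_concat z b (a :: u) (S.rs z y) m
      simp only [List.cons_append] at this
      rw [if_pos (List.isChain_cons_cons.2 ⟨hz, hl⟩), if_pos hz,
        if_pos (List.isChain_cons_cons.2 ⟨hz, isChain_left hl⟩), this]
      simp [pow_succ, sub_eq_add_neg]
    · simp [hz]
  rw [h1]
  abel

lemma hty_spec {n j : ℕ} (hn : n ≠ 0) {y : S.Amb M} (hy : y ∈ S.Fil (j + 1)) :
    S.proj n y - S.diff (S.hty (S.proj n y)) - S.hty (S.diff (S.proj n y)) ∈ S.Fil j := by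
  let F : S.Amb M →+ S.Amb M := AddMonoidHom.id _ - S.diff.toAddMonoidHom.comp S.hty -
    S.hty.comp S.diff.toAddMonoidHom
  suffices h : S.Fil (j + 1) ≤ (S.Fil j).comap (F.comp (S.proj n).toAddMonoidHom) from h hy
  refine (AddSubgroup.closure_le _).2 ?_
  rintro _ ⟨l, y, m, hy, rfl⟩
  change F (S.proj n (S.sg l (y ⊗ₜ[k] m))) ∈ S.Fil j
  by_cases hl : l.IsChain rel ∧ l.length = n
  swap
  · rw [S.proj_single_of_not hl, map_zero]
    exact zero_mem _
  rw [S.proj_single hl.1 hl.2]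
  refine S.pr_tmul_mem l y m ((S.Fil j).comap (F.comp (S.sg l).toAddMonoidHom)) ?_
  intro v u hvu
  have hy' := S.mul_e_mem_filt hy v
  have hf := S.fits_ends hvu y m
  revert hy' hf
  generalize y * S.e v = y', S.e u • m = m'
  intro hy' hf
  change S.sg l (y' ⊗ₜ[k] m') - S.diff (S.hty (S.sg l (y' ⊗ₜ[k] m'))) -
    S.hty (S.diff (S.sg l (y' ⊗ₜ[k] m'))) ∈ S.Fil j
  rcases list_cases l with rfl | ⟨a, rfl⟩ | ⟨a, u, b, rfl⟩
  · exact absurd hl.2.symm hn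
  · exact S.hty_spec_singleton m' (fits_cons.1 hf).1 hy'
  · rw [S.hty_spec_concat hl.1 m' (fits_cons.1 hf).1]
    exact zero_mem _

lemma exact_of_mem_Fil (hc : ∀ a b, rel a b → Q.tgt a = Q.src b) (n j : ℕ) (y : S.Amb M)
    (hj : y ∈ S.Fil j) (hp : S.proj (n + 1) y = y) (h : S.diff y = 0) :
    ∃ z, S.diff (S.proj (n + 2) z) = y := by
  induction j generalizing y with
  | zero =>
    have : S.Fil (M := M) 0 = ⊥ := by
      refine (AddSubgroup.closure_eq_bot_iff).2 ?_
      rintro _ ⟨l, y, m, hy, rfl⟩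
      obtain rfl : y = 0 := by simpa [filt] using hy
      simp
    rw [this, AddSubgroup.mem_bot] at hj
    exact ⟨0, by simp [hj]⟩
  | succ j ih =>
    have hs : S.proj (n + 2) (S.hty y) = S.hty y := by
      have := S.proj_hty_proj (n := n + 1) (by simp) y
      rwa [hp] at this
    have h1 := S.hty_spec (n := n + 1) (by simp) hj
    rw [hp, h, map_zero, sub_zero] at h1
    obtain ⟨z, hz⟩ := ih (y - S.diff (S.hty y)) h1
      (by
        rw [map_sub, hp]
        have := S.proj_diff_proj hc (n + 1) (S.hty y)
        rw [hs] at this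
        rw [this])
      (by
        have := S.diff_diff_proj n (S.hty y)
        rw [hs] at this
        rw [map_sub, h, this, sub_zero])
    exact ⟨z + S.hty y, by rw [map_add, map_add, hz, hs, sub_add_cancel]⟩

lemma exact_succ (hc : ∀ a b, rel a b → Q.tgt a = Q.src b) (n : ℕ) (y : S.Amb M)
    (hp : S.proj (n + 1) y = y) (h : S.diff y = 0) : ∃ z, S.diff (S.proj (n + 2) z) = y := by
  obtain ⟨j, hj⟩ := S.exists_mem_Fil y
  exact S.exact_of_mem_Fil hc n j y hj hp h

end PathStructure

namespace PathStructure

variable {k R : Type} [Field k] [Ring R] [Algebra k R] {Q : Quiv} {rel : Q.Arr → Q.Arr → Prop}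
  (S : PathStructure k R Q rel) (M : Type) [AddCommGroup M] [Module k M] [Module R M]
  [IsScalarTower k R M]

/-- The terms of the Koszul resolution. -/
abbrev Term (n : ℕ) : Type := (S.proj (M := M) n).range

variable {M}

lemma proj_coe {n : ℕ} (y : S.Term M n) : S.proj n (y : S.Amb M) = y := by
  obtain ⟨_, z, rfl⟩ := y
  exact S.proj_proj n z

instance (n : ℕ) : Module.Projective R (S.Term M n) :=
  Module.Projective.of_split (S.proj (M := M) n).range.subtype (S.proj n).rangeRestrict
    (LinearMap.ext fun y => Subtype.ext (S.proj_coe y))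

/-- The differential of the Koszul resolution. -/
def termDiff (hc : ∀ a b, rel a b → Q.tgt a = Q.src b) (n : ℕ) :
    S.Term M (n + 1) →ₗ[R] S.Term M n :=
  (S.diff ∘ₗ Submodule.subtype _).codRestrict _ fun y =>
    ⟨S.diff y, by have := S.proj_diff_proj hc n (y : S.Amb M); rwa [S.proj_coe] at this⟩

/-- `Ext` computed by the Koszul resolution. -/
theorem subsingleton_ext_iff (hc : ∀ a b, rel a b → Q.tgt a = Q.src b) (N : ModuleCat.{0} R)
    (n : ℕ) :
    Subsingleton (((Ext ℤ (ModuleCat R) (n + 1)).obj (Opposite.op (ModuleCat.of R M))).obj N) ↔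
      ∀ f : S.Amb M →ₗ[R] N, (∀ y, f (S.diff (S.proj (n + 2) y)) = 0) →
        ∃ g : S.Amb M →ₗ[R] N, ∀ y, g (S.diff (S.proj (n + 1) y)) = f (S.proj (n + 1) y) := by
  rw [subsingleton_ext_succ_iff (fun n => S.Term M n) (S.termDiff hc) (ModuleCat.of R M)
    (S.aug.domRestrict _ : S.Term M 0 →ₗ[R] M)]
  · constructor
    · intro H f hf
      obtain ⟨g, hg⟩ := H (f ∘ₗ Submodule.subtype _) (LinearMap.ext fun y => by
        have := hf y
        rw [S.proj_coe] at this
        exact this)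
      refine ⟨g ∘ₗ (S.proj n).rangeRestrict, fun y => ?_⟩
      have := LinearMap.congr_fun hg ((S.proj (n + 1)).rangeRestrict y)
      refine Eq.trans ?_ this
      change g _ = g _
      congr 1
      exact Subtype.ext (S.proj_diff_proj hc n y)
    · intro H f hf
      obtain ⟨g, hg⟩ := H (f ∘ₗ (S.proj (n + 1)).rangeRestrict) (fun y => by
        have := LinearMap.congr_fun hf ((S.proj (n + 2)).rangeRestrict y)
        refine Eq.trans ?_ this
        change f _ = f _
        congr 1
        exact Subtype.ext (S.proj_diff_proj hc (n + 1) y))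
      refine ⟨g ∘ₗ Submodule.subtype _, LinearMap.ext fun y => ?_⟩
      have := hg y
      rw [S.proj_coe] at this
      refine Eq.trans this ?_
      change f _ = f _
      congr 1
      exact Subtype.ext (S.proj_coe y)
  · intro m
    exact ⟨⟨S.incl m, S.incl m, S.proj_incl m⟩, S.aug_incl m⟩
  · intro y
    constructor
    · intro h
      obtain ⟨z, hz⟩ := S.exact_zero y.1 (by rw [S.proj_coe]; exact h)
      exact ⟨(S.proj 1).rangeRestrict z, Subtype.ext (hz.trans (S.proj_coe y))⟩
    · rintro ⟨z, rfl⟩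
      have := S.aug_diff_proj (z : S.Amb M)
      rwa [S.proj_coe] at this
  · intro n y
    constructor
    · intro h
      obtain ⟨z, hz⟩ := S.exact_succ hc n y.1 (S.proj_coe y) (congrArg Subtype.val h)
      exact ⟨(S.proj (n + 2)).rangeRestrict z, Subtype.ext hz⟩
    · rintro ⟨z, rfl⟩
      have := S.diff_diff_proj n (z : S.Amb M)
      rw [S.proj_coe] at this
      exact Subtype.ext this

end PathStructure

namespace PathStructure

variable {k R : Type} [Field k] [Ring R] [Algebra k R] {Q : Quiv} {rel : Q.Arr → Q.Arr → Prop}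
  (S : PathStructure k R Q rel) {M : Type} [AddCommGroup M] [Module k M] [Module R M]
  [IsScalarTower k R M]

/-- The `R`-linear map on the ambient module given by a family of `k`-linear maps. -/
def coch (g : List Q.Arr → (M →ₗ[k] R)) : S.Amb M →ₗ[R] R := S.liftL fun l =>
  TensorProduct.AlgebraTensorModule.lift (LinearMap.toSpanSingleton R (M →ₗ[k] R) (g l))

@[simp] lemma coch_sg (g : List Q.Arr → (M →ₗ[k] R)) (l : List Q.Arr) (y : R) (m : M) :
    S.coch g (S.sg l (y ⊗ₜ[k] m)) = y * g l m := by
  simp [coch]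

lemma map_proj_sg (f : S.Amb M →ₗ[R] R) (n : ℕ) (l : List Q.Arr) (y : R) (m : M) :
    f (S.proj n (S.sg l (y ⊗ₜ[k] m))) = y * f (S.proj n (S.sg l (1 ⊗ₜ[k] m))) := by
  rw [← smul_eq_mul, ← map_smul, ← map_smul, ← map_smul, TensorProduct.smul_tmul', smul_eq_mul,
    mul_one]

/-- The components of a linear map on a term of the Koszul resolution. -/
def comp (f : S.Amb M →ₗ[R] R) (n : ℕ) (l : List Q.Arr) : M →ₗ[k] R where
  toFun m := f (S.proj n (S.sg l (1 ⊗ₜ[k] m)))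
  map_add' m m' := by simp [TensorProduct.tmul_add]
  map_smul' r m := by
    rw [← TensorProduct.smul_tmul, S.map_proj_sg]
    simp

lemma comp_apply (f : S.Amb M →ₗ[R] R) (n : ℕ) (l : List Q.Arr) (m : M) :
    S.comp f n l m = f (S.proj n (S.sg l (1 ⊗ₜ[k] m))) := rfl

lemma map_proj_sg' (f : S.Amb M →ₗ[R] R) (n : ℕ) (l : List Q.Arr) (y : R) (m : M) :
    f (S.proj n (S.sg l (y ⊗ₜ[k] m))) = y * S.comp f n l m := S.map_proj_sg f n l y m

lemma comp_of_not (f : S.Amb M →ₗ[R] R) {n : ℕ} {l : List Q.Arr}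
    (hl : ¬ (l.IsChain rel ∧ l.length = n)) (m : M) : S.comp f n l m = 0 := by
  rw [comp_apply, S.proj_single_of_not hl, map_zero]

lemma pr_of_eq {l w u : List Q.Arr} {a b : Q.Arr} (h1 : l = a :: w) (h2 : l = u ++ [b]) (y : R)
    (m : M) : S.pr l (y ⊗ₜ[k] m) = (y * S.e (Q.src a)) ⊗ₜ[k] (S.e (Q.tgt b) • m) := by
  subst h1
  simp [pr, h2]

lemma diff_of_eq {l w u : List Q.Arr} {a b : Q.Arr} (h1 : l = a :: w) (h2 : l = u ++ [b]) (y : R)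
    (m : M) : S.diff (S.sg l (y ⊗ₜ[k] m)) = S.sg w ((y * S.x a) ⊗ₜ[k] m) +
      (-1 : ℤ) ^ l.length • S.sg u (y ⊗ₜ[k] (S.x b • m)) := by
  subst h1
  have h3 : w.length = u.length := by simpa using congrArg List.length h2
  rw [diff_single_cons]
  simp [h2, h3]

lemma e_mul_comp (f : S.Amb M →ₗ[R] R) {n : ℕ} {a : Q.Arr} {w : List Q.Arr} (m : M) :
    S.e (Q.src a) * S.comp f n (a :: w) m = S.comp f n (a :: w) m := by
  rw [← map_proj_sg', comp_apply]
  by_cases hl : (a :: w).IsChain rel ∧ (a :: w).length = n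
  · rw [S.proj_single hl.1 hl.2, S.proj_single hl.1 hl.2]
    simp only [pr, tm_tmul, S.e_mul_self, one_mul]
  · rw [S.proj_single_of_not hl, S.proj_single_of_not hl]

lemma comp_e_smul (f : S.Amb M →ₗ[R] R) {n : ℕ} {l u : List Q.Arr} {b : Q.Arr}
    (h : l = u ++ [b]) (m : M) : S.comp f n l (S.e (Q.tgt b) • m) = S.comp f n l m := by
  obtain ⟨a, w, hw⟩ : ∃ a w, l = a :: w := List.exists_cons_of_ne_nil (by simp [h])
  rw [comp_apply, comp_apply]
  by_cases hl : l.IsChain rel ∧ l.length = n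
  · rw [S.proj_single hl.1 hl.2, S.proj_single hl.1 hl.2, S.pr_of_eq hw h, S.pr_of_eq hw h,
      ← mul_smul, S.e_mul_self]
  · rw [S.proj_single_of_not hl, S.proj_single_of_not hl]

lemma diff_proj_one {n : ℕ} {l w u : List Q.Arr} {a b : Q.Arr} (h1 : l = a :: w)
    (h2 : l = u ++ [b]) (hl : l.IsChain rel) (hn : l.length = n) (m : M) :
    S.diff (S.proj n (S.sg l (1 ⊗ₜ[k] m))) = S.sg w (S.x a ⊗ₜ[k] (S.e (Q.tgt b) • m)) +
      (-1 : ℤ) ^ n • S.sg u (S.e (Q.src a) ⊗ₜ[k] (S.x b • m)) := by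
  rw [S.proj_single hl hn, S.pr_of_eq h1 h2, S.diff_of_eq h1 h2, ← mul_smul, S.x_mul_e, hn,
    one_mul, S.e_mul_x]

lemma comp_cocycle (hc : ∀ a b, rel a b → Q.tgt a = Q.src b) {n : ℕ} (f : S.Amb M →ₗ[R] R)
    (hf : ∀ y, f (S.diff (S.proj (n + 2) y)) = 0) {z b : Q.Arr} {u : List Q.Arr}
    (hl : (z :: (u ++ [b])).IsChain rel) (hn : u.length = n) (m : M) :
    S.x z * S.comp f (n + 1) (u ++ [b]) m +
      (-1 : ℤ) ^ n • S.comp f (n + 1) (z :: u) (S.x b • m) = 0 := by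
  have h := hf (S.sg (z :: (u ++ [b])) (1 ⊗ₜ[k] m))
  rw [← S.proj_diff_proj hc, S.diff_proj_one rfl (u := z :: u) (b := b) (by simp) hl (by simp [hn]),
    map_add, map_add, map_proj_sg', map_zsmul, map_zsmul, map_proj_sg', e_mul_comp,
    S.comp_e_smul f rfl] at h
  simpa [pow_succ] using h

lemma eq_zero_of_comp {n : ℕ} (f : S.Amb M →ₗ[R] R)
    (h : ∀ l m, l.IsChain rel → l.length = n → S.comp f n l m = 0) (y : S.Amb M) :
    f (S.proj n y) = 0 := by
  refine S.amb_induction (p := fun y => f (S.proj n y) = 0) y (by simp)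
    (fun p q hp hq => by rw [map_add, map_add, hp, hq, add_zero]) fun l y m => ?_
  rw [map_proj_sg']
  by_cases hl : l.IsChain rel ∧ l.length = n
  · rw [h l m hl.1 hl.2, mul_zero]
  · rw [S.comp_of_not f hl, mul_zero]

lemma exists_eq_cons_concat {l : List Q.Arr} {n : ℕ} (h : l.length = n + 1) :
    ∃ a w u b, l = a :: w ∧ l = u ++ [b] ∧ w.length = n ∧ u.length = n := by
  have hne : l ≠ [] := by rintro rfl; simp at h
  obtain ⟨a, w, hw⟩ := List.exists_cons_of_ne_nil hne
  obtain ⟨u, b, hu⟩ := (List.eq_nil_or_concat l).resolve_left hne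
  refine ⟨a, w, u, b, hw, by simpa using hu, ?_, ?_⟩
  · simpa [hw] using h
  · simpa [hu] using h

lemma ls_comp_eq_zero (hg : IsGentleRel Q rel) (n : ℕ)
    (hn : n = 0 → (∀ a b, Q.tgt a = Q.tgt b → a = b) ∧ ∀ a b, Q.tgt a = Q.src b → rel a b)
    (f : S.Amb M →ₗ[R] R) {a : Q.Arr} {w : List Q.Arr} (hl : (a :: w).IsChain rel)
    (hln : (a :: w).length = n + 1) (m : M) :
    S.ls a (S.comp (f - S.coch (fun l => ∑ c, S.ls c ∘ₗ S.comp f (n + 1) (c :: l)) ∘ₗ S.diff)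
      (n + 1) (a :: w) m) = 0 := by
  obtain ⟨a, w, u, b, h1, h2, hwn, hun⟩ := exists_eq_cons_concat hln
  obtain ⟨rfl, rfl⟩ := List.cons_eq_cons.1 h1
  rw [comp_apply, LinearMap.sub_apply, ← comp_apply, LinearMap.comp_apply,
    S.diff_proj_one rfl h2 hl hln, map_add, map_zsmul, coch_sg, coch_sg, map_sub, map_add,
    map_zsmul]
  have e1 : S.x a * (∑ c, S.ls c ∘ₗ S.comp f (n + 1) (c :: w)) (S.e (Q.tgt b) • m) =
      S.x a * S.ls a (S.comp f (n + 1) (a :: w) m) := by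
    rw [LinearMap.sum_apply, Finset.mul_sum, Finset.sum_eq_single a]
    · rw [LinearMap.comp_apply, S.comp_e_smul f h2]
    · intro c _ hca
      rw [LinearMap.comp_apply]
      by_cases hcw : (c :: w).IsChain rel
      swap
      · rw [S.comp_of_not f (by simp [hcw]), map_zero, mul_zero]
      cases w with
      | nil =>
        rw [← S.x_mul_e, ← S.e_mul_ls, mul_assoc, ← mul_assoc (S.e _), S.e_mul_of_ne, zero_mul,
          mul_zero]
        exact fun h => hca ((hn (by simpa using hwn.symm)).1 _ _ h).symm
      | cons d w =>
        have h1 := (List.isChain_cons_cons.1 hcw).1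
        have h2 := (List.isChain_cons_cons.1 hl).1
        have := hg.cond_ii d c a hca (hg.rel_comp _ _ h1) (hg.rel_comp _ _ h2)
        exact (this.elim (fun h => h.2 h2) fun h => h.2 h1).elim
    · simp
  have e2 : S.ls a (S.e (Q.src a) *
      (∑ c, S.ls c ∘ₗ S.comp f (n + 1) (c :: u)) (S.x b • m)) = 0 := by
    rw [S.ls_e_mul, LinearMap.sum_apply, map_sum]
    refine Finset.sum_eq_zero fun c _ => ?_
    rw [LinearMap.comp_apply]
    by_cases hcw : (c :: u).IsChain rel
    swap
    · rw [S.comp_of_not f (by simp [hcw]), map_zero, map_zero]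
    refine S.ls_ls _ _ _ ?_
    cases u with
    | nil =>
      by_cases h : Q.tgt c = Q.src a
      · exact Or.inl ((hn (by simpa using hun.symm)).2 _ _ h)
      · exact Or.inr h
    | cons d u =>
      obtain rfl : a = d := (List.cons_eq_cons.1 h2).1
      exact Or.inl (List.isChain_cons_cons.1 hcw).1
  rw [e1, e2, S.ls_x_mul, S.e_mul_ls, Finset.sum_eq_zero]
  · simp
  · intro z _
    split_ifs with hz
    · rw [S.ls_ls _ _ _ (Or.inl hz), mul_zero]
    · rfl

/-- `Ext` into the regular module vanishes in degree `n + 1` if all relevant words can be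
extended to the left. -/
theorem subsingleton_ext_of_extendable (S : PathStructure k R Q rel) (hg : IsGentleRel Q rel)
    (M : ModuleCat.{0} R) (n : ℕ)
    (hn : n = 0 → (∀ a b, Q.tgt a = Q.tgt b → a = b) ∧ ∀ a b, Q.tgt a = Q.src b → rel a b)
    (hext : ∀ l : List Q.Arr, l.IsChain rel → l.length = n + 1 → ∃ z, (z :: l).IsChain rel) :
    Subsingleton (((Ext ℤ (ModuleCat R) (n + 1)).obj (Opposite.op M)).obj
      (ModuleCat.of R R)) := by
  let := Module.compHom M (algebraMap k R)
  have : IsScalarTower k R M := ⟨fun r y m => by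
    rw [Algebra.smul_def, mul_smul]; rfl⟩
  change Subsingleton (((Ext ℤ (ModuleCat R) (n + 1)).obj
    (Opposite.op (ModuleCat.of R M))).obj (ModuleCat.of R R))
  rw [S.subsingleton_ext_iff hg.rel_comp]
  intro f hf
  set G := S.coch (fun l => ∑ c, S.ls c ∘ₗ S.comp f (n + 1) (c :: l)) with hG
  refine ⟨G, fun y => ?_⟩
  suffices h : (f - G ∘ₗ S.diff) (S.proj (n + 1) y) = 0 by
    rw [LinearMap.sub_apply, LinearMap.comp_apply, sub_eq_zero] at h
    exact h.symm
  have hf' : ∀ y, (f - G ∘ₗ S.diff) (S.diff (S.proj (n + 2) y)) = 0 := fun y => by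
    rw [LinearMap.sub_apply, LinearMap.comp_apply, diff_diff_proj, hf, map_zero, sub_zero]
  refine S.eq_zero_of_comp _ (fun l m hl hln => ?_) y
  obtain ⟨a, w, u, b, h1, h2, hwn, hun⟩ := exists_eq_cons_concat hln
  obtain ⟨z, hz⟩ := hext l hl hln
  have hza : rel z a := by
    rw [h1] at hz
    exact (List.isChain_cons_cons.1 hz).1
  have hL {a : Q.Arr} {w : List Q.Arr} (hl : (a :: w).IsChain rel)
    (hln : (a :: w).length = n + 1) (m : M) := S.ls_comp_eq_zero hg n hn f hl hln m
  rw [← hG] at hL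
  have hzu : (z :: u).IsChain rel := by
    rw [h2] at hz
    exact isChain_left hz
  have key := congrArg (S.ls z) (S.comp_cocycle hg.rel_comp _ hf' (h2 ▸ hz) hun m)
  rw [map_add, map_zsmul, hL hzu (by simp [hun]), smul_zero, add_zero, map_zero, S.ls_x_mul,
    Finset.sum_eq_zero, sub_zero, ← h2, hg.rel_comp _ _ hza] at key
  · subst h1
    rwa [e_mul_comp] at key
  · intro c _
    split_ifs with hzc
    swap
    · rfl
    obtain rfl : c = a := by
      by_contra hca
      have := hg.cond_iii z c a hca (hg.rel_comp _ _ hzc) (hg.rel_comp _ _ hza)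
      exact this.elim (fun h => h.2 hza) fun h => h.2 hzc
    rw [← h2, h1, hL (h1 ▸ hl) (h1 ▸ hln), mul_zero]

end PathStructure

namespace PathStructure

variable {k R : Type} [Field k] [Ring R] [Algebra k R] {Q : Quiv} {rel : Q.Arr → Q.Arr → Prop}
  (S : PathStructure k R Q rel)

/-- The simple module at a vertex. -/
abbrev simpleModule (v : Q.V) : Module R k := Module.compHom k (S.c v : R →+* k)

lemma simple_isScalarTower (v : Q.V) :
    let := S.simpleModule v
    IsScalarTower k R k := by
  let := S.simpleModule v
  exact ⟨fun r y m => by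
    change S.c v (r • y) * m = r * (S.c v y * m)
    rw [map_smul, smul_eq_mul, mul_assoc]⟩

section
variable {M : Type} [AddCommGroup M] [Module k M] [Module R M] [IsScalarTower k R M]

lemma map_sg (g : S.Amb M →ₗ[R] R) (l : List Q.Arr) (y : R) (m : M) :
    g (S.sg l (y ⊗ₜ[k] m)) = y * g (S.sg l (1 ⊗ₜ[k] m)) := by
  rw [← smul_eq_mul, ← map_smul, ← map_smul, TensorProduct.smul_tmul', smul_eq_mul, mul_one]

lemma coch_cocycle (hM : ∀ a (m : M), S.x a • m = 0) (g : List Q.Arr → (M →ₗ[k] R)) (n : ℕ)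
    (hg : ∀ a w m, (a :: w).IsChain rel → w.length = n → S.x a * g w m = 0) (y : S.Amb M) :
    S.coch g (S.diff (S.proj (n + 1) y)) = 0 := by
  have := S.proj_hom_ext (n + 1) ((S.coch g) ∘ₗ S.diff).toAddMonoidHom 0 ?_ y
  · exact this
  intro l hl hn y m _
  obtain ⟨a, w, u, b, h1, h2, hwn, hun⟩ := exists_eq_cons_concat hn
  simp only [LinearMap.toAddMonoidHom_coe, LinearMap.coe_comp, Function.comp_apply,
    AddMonoidHom.zero_apply]
  rw [S.diff_of_eq h1 h2, map_add, map_zsmul, coch_sg, coch_sg, hM, map_zero, mul_zero, mul_assoc,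
    hg a w m (h1 ▸ hl) hwn]
  simp

lemma map_diff_proj_sg (hM : ∀ a (m : M), S.x a • m = 0) (g : S.Amb M →ₗ[R] R) {n : ℕ}
    {l w u : List Q.Arr} {a b : Q.Arr} (h1 : l = a :: w) (h2 : l = u ++ [b])
    (hl : l.IsChain rel) (hn : l.length = n) (m : M) :
    g (S.diff (S.proj n (S.sg l (1 ⊗ₜ[k] m)))) =
      S.x a * g (S.sg w (1 ⊗ₜ[k] (S.e (Q.tgt b) • m))) := by
  rw [S.diff_proj_one h1 h2 hl hn, hM]
  simp [← S.map_sg g]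

end

/-- A forbidden word which cannot be extended to the left gives a non-trivial extension. -/
theorem exists_not_subsingleton_ext (S : PathStructure k R Q rel) (hg : IsGentleRel Q rel) {l : List Q.Arr} {n : ℕ}
    (hl : l.IsChain rel) (hn : l.length = n + 1) (hmax : ∀ z, ¬ (z :: l).IsChain rel) :
    ∃ M : ModuleCat.{0} R, ¬ Subsingleton (((Ext ℤ (ModuleCat R) (n + 1)).obj (Opposite.op M)).obj
      (ModuleCat.of R R)) := by
  classical
  obtain ⟨a, w, u, b, h1, h2, hwn, hun⟩ := exists_eq_cons_concat hn
  let := S.simpleModule (Q.tgt b)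
  have := S.simple_isScalarTower (Q.tgt b)
  have hM (a) (m : k) : S.x a • m = 0 := by
    change S.c _ (S.x a) * m = 0
    rw [S.c_x, zero_mul]
  have hM' (m : k) : S.e (Q.tgt b) • m = m := by
    change S.c _ (S.e (Q.tgt b)) * m = m
    rw [S.c_e, one_mul]
  refine ⟨ModuleCat.of R k, fun h => ?_⟩
  rw [S.subsingleton_ext_iff hg.rel_comp] at h
  obtain ⟨g, hgf⟩ := h (S.coch fun l' => if l' = l then
    LinearMap.toSpanSingleton k R (S.e (Q.src a)) else 0) (S.coch_cocycle hM _ _ (by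
      intro z w m hz _
      by_cases hw : w = l
      · exact absurd hz (hw ▸ hmax z)
      · simp [hw]))
  have := congrArg (S.c (Q.src a)) (hgf (S.sg l (1 ⊗ₜ[k] 1)))
  rw [S.map_diff_proj_sg hM _ h1 h2 hl hn, map_mul, S.c_x, zero_mul, S.proj_single hl hn,
    S.pr_of_eq h1 h2, hM', coch_sg] at this
  simp [S.c_e, S.e_mul_self] at this

/-- Two arrows with the same target give a non-trivial extension. -/
theorem exists_not_subsingleton_ext_one (S : PathStructure k R Q rel) (hg : IsGentleRel Q rel) {a b : Q.Arr} (hab : a ≠ b)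
    (ht : Q.tgt a = Q.tgt b) :
    ∃ M : ModuleCat.{0} R, ¬ Subsingleton (((Ext ℤ (ModuleCat R) 1).obj (Opposite.op M)).obj
      (ModuleCat.of R R)) := by
  classical
  let := S.simpleModule (Q.tgt a)
  have := S.simple_isScalarTower (Q.tgt a)
  have hM (b) (m : k) : S.x b • m = 0 := by
    change S.c _ (S.x b) * m = 0
    rw [S.c_x, zero_mul]
  have hM' (m : k) : S.e (Q.tgt a) • m = m := by
    change S.c _ (S.e (Q.tgt a)) * m = m
    rw [S.c_e, one_mul]
  refine ⟨ModuleCat.of R k, fun h => ?_⟩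
  rw [S.subsingleton_ext_iff hg.rel_comp _ 0] at h
  obtain ⟨g, hgf⟩ := h (S.coch fun l' => if l' = [a] then
    LinearMap.toSpanSingleton k R (S.x a) else 0) (S.coch_cocycle hM _ _ (by
      intro z w m hz _
      by_cases hw : w = [a]
      · subst hw
        have : rel z a := by simpa using hz
        simp [S.x_mul_x _ _ this]
      · simp [hw]))
  have key (d : Q.Arr) (hd : Q.tgt d = Q.tgt a) (G : R) :
      S.c (Q.tgt a) (S.ls d (S.x d * G)) = S.c (Q.tgt a) G := by
    rw [S.ls_x_mul, map_sub, map_mul, map_sum, hd, S.c_e, one_mul, Finset.sum_eq_zero, sub_zero]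
    intro z _
    split_ifs
    · rw [map_mul, S.c_x, zero_mul]
    · rw [map_zero]
  have ha := hgf (S.sg [a] (1 ⊗ₜ[k] 1))
  have hb := hgf (S.sg [b] (1 ⊗ₜ[k] 1))
  rw [S.map_diff_proj_sg hM _ (n := 0 + 1) (w := []) (u := []) rfl rfl (by simp) rfl,
    S.proj_single (n := 0 + 1) (by simp) rfl, S.pr_of_eq (w := []) (u := []) rfl rfl, hM', coch_sg] at ha
  rw [S.map_diff_proj_sg hM _ (n := 0 + 1) (w := []) (u := []) rfl rfl (by simp) rfl,
    S.proj_single (n := 0 + 1) (by simp) rfl, S.pr_of_eq (w := []) (u := []) rfl rfl, ← ht, hM',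
    coch_sg] at hb
  have ha' : S.x a * g (S.sg [] (1 ⊗ₜ[k] 1)) = S.x a * 1 := by simpa [S.e_mul_x] using ha
  have hb' : S.x b * g (S.sg [] (1 ⊗ₜ[k] 1)) = 0 := by simpa [hab.symm] using hb
  have h1 := key a rfl (g (S.sg [] (1 ⊗ₜ[k] 1)))
  have h2 := key b ht.symm (g (S.sg [] (1 ⊗ₜ[k] 1)))
  rw [ha', key _ rfl, map_one] at h1
  rw [hb', map_zero, map_zero, ← h1] at h2
  exact zero_ne_one h2

end PathStructure

section
variable {Q : Quiv} {rel : Q.Arr → Q.Arr → Prop}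

lemma IsGentleRel.eq_of_rel_left (hg : IsGentleRel Q rel) {a b c : Q.Arr} (ha : rel a c)
    (hb : rel b c) : a = b := by
  by_contra h
  rcases hg.cond_ii c a b h (hg.rel_comp _ _ ha) (hg.rel_comp _ _ hb) with h | h <;> tauto

lemma IsGentleRel.eq_of_rel_right (hg : IsGentleRel Q rel) {a b c : Q.Arr} (ha : rel c a)
    (hb : rel c b) : a = b := by
  by_contra h
  rcases hg.cond_iii c a b h (hg.rel_comp _ _ ha) (hg.rel_comp _ _ hb) with h | h <;> tauto

lemma allowedWord_dualRel_iff (hg : IsGentleRel Q rel) {l : List Q.Arr} :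
    AllowedWord (dualRel rel) l ↔ l.IsChain rel := by
  have : (fun a b => Q.tgt a = Q.src b ∧ ¬ dualRel rel a b) = rel := by
    funext a b
    have := hg.rel_comp a b
    simp only [dualRel, eq_iff_iff]
    tauto
  rw [AllowedWord, this]
  rfl

lemma finiteMaxWord_dualRel_iff (hg : IsGentleRel Q rel) {l : List Q.Arr} :
    FiniteMaxWord (dualRel rel) l ↔ l ≠ [] ∧ l.IsChain rel ∧ (∀ z, ¬ (l ++ [z]).IsChain rel) ∧
      ∀ z, ¬ (z :: l).IsChain rel := by
  simp only [FiniteMaxWord, RightMaxWord, LeftMaxWord, allowedWord_dualRel_iff hg]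
  tauto

/-- A forbidden word which cannot be extended to the left has no repeated arrow. -/
lemma nodup_of_left_maximal (hg : IsGentleRel Q rel) {l : List Q.Arr} (hl : l.IsChain rel)
    (hmax : ∀ z, ¬ (z :: l).IsChain rel) : l.Nodup := by
  rw [List.nodup_iff_getElem?_ne_getElem?]
  intro i j hij hj h
  rw [List.getElem?_eq_getElem (hij.trans hj), List.getElem?_eq_getElem hj, Option.some_inj] at h
  have hch := List.isChain_iff_getElem.1 hl
  induction i generalizing j with
  | zero =>
    obtain ⟨j, rfl⟩ := Nat.exists_eq_add_one_of_ne_zero hij.ne'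
    refine hmax l[j] ?_
    cases l with
    | nil => simp at hj
    | cons a w =>
      have := hch j hj
      rw [← h] at this
      exact List.IsChain.cons_cons this hl
  | succ i ih =>
    obtain ⟨j, rfl⟩ := Nat.exists_eq_add_one_of_ne_zero (n := j) (by omega)
    refine ih j (by omega) (by omega) (hg.eq_of_rel_left (c := l[j + 1]) ?_ (hch j hj))
    rw [← h]
    exact hch i (by omega)

lemma exists_finiteMaxWord (hg : IsGentleRel Q rel) {l : List Q.Arr} (hne : l ≠ [])
    (hl : l.IsChain rel) (hmax : ∀ z, ¬ (z :: l).IsChain rel) :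
    ∃ m, FiniteMaxWord (dualRel rel) m ∧ l.length ≤ m.length := by
  have hcard := (nodup_of_left_maximal hg hl hmax).length_le_card
  induction hn : Fintype.card Q.Arr - l.length generalizing l with
  | zero =>
    refine ⟨l, (finiteMaxWord_dualRel_iff hg).2 ⟨hne, hl, fun z hz => ?_, hmax⟩, le_rfl⟩
    have := (nodup_of_left_maximal hg hz fun y hy => hmax y
      (List.IsChain.left_of_append (l₁ := y :: l) (l₂ := [z]) hy)).length_le_card
    simp at this
    omega
  | succ n ih =>
    by_cases h : ∃ z, (l ++ [z]).IsChain rel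
    · obtain ⟨z, hz⟩ := h
      have hmz : ∀ y, ¬ (y :: (l ++ [z])).IsChain rel := fun y hy => hmax y
        (List.IsChain.left_of_append (l₁ := y :: l) (l₂ := [z]) hy)
      obtain ⟨m, hm, hle⟩ := ih (by simp) hz hmz (nodup_of_left_maximal hg hz hmz).length_le_card
        (by simp; omega)
      refine ⟨m, hm, le_trans ?_ hle⟩
      simp
    · push Not at h
      exact ⟨l, (finiteMaxWord_dualRel_iff hg).2 ⟨hne, hl, h, hmax⟩, le_rfl⟩

lemma exists_incident_arrow (v : Q.V) : ∃ a, Q.src a = v ∨ Q.tgt a = v := by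
  obtain ⟨a⟩ := Q.nonemptyA
  obtain ⟨p⟩ := Q.connected.preconnected v (Q.src a)
  cases p with
  | nil => exact ⟨a, Or.inl rfl⟩
  | cons h _ =>
    obtain ⟨-, ⟨b, hb, -⟩ | ⟨b, -, hb⟩⟩ := h
    · exact ⟨b, Or.inl hb⟩
    · exact ⟨b, Or.inr hb⟩

lemma eq_of_indeg_eq_one {v : Q.V} (h : indeg Q v = 1) {a b : Q.Arr} (ha : Q.tgt a = v)
    (hb : Q.tgt b = v) : a = b :=
  Finset.card_le_one.1 h.le a (by simp [ha]) b (by simp [hb])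

lemma exists_of_indeg_eq_one {v : Q.V} (h : indeg Q v = 1) : ∃ a, Q.tgt a = v := by
  obtain ⟨a, ha⟩ := Finset.card_pos.1 (h ▸ Nat.one_pos : 0 < indeg Q v)
  exact ⟨a, by simpa using ha⟩

/-- A quiver with injective target map in which every forbidden word extends to the left is an
oriented cycle, all of whose paths of length two are relations. -/
lemma isAtilde_of_extendable (hg : IsGentleRel Q rel) (hinj : Function.Injective Q.tgt)
    (hext : ∀ a, ∃ z, rel z a) :
    IsAtilde Q ∧ ∀ a b : Q.Arr, Q.tgt a = Q.src b → rel a b := by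
  choose p hp using hext
  have hpc (a) : Q.tgt (p a) = Q.src a := hg.rel_comp _ _ (hp a)
  have hpi : Function.Injective p := fun a b h => hg.eq_of_rel_right (hp a) (h ▸ hp b)
  have hps : Function.Surjective p := Finite.surjective_of_injective hpi
  have hin (v) : ∃ a, Q.tgt a = v := by
    obtain ⟨a, h | h⟩ := exists_incident_arrow v
    · exact ⟨p a, (hpc a).trans h⟩
    · exact ⟨a, h⟩
  refine ⟨fun v => ⟨?_, ?_⟩, fun a b h => ?_⟩
  · obtain ⟨a, ha⟩ := hin v
    refine Finset.card_eq_one.2 ⟨a, ?_⟩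
    ext b
    simp only [Finset.mem_filter, Finset.mem_univ, true_and, Finset.mem_singleton]
    exact ⟨fun hb => hinj (hb.trans ha.symm), fun hb => hb ▸ ha⟩
  · obtain ⟨a, ha⟩ := hin v
    obtain ⟨b, rfl⟩ := hps a
    refine Finset.card_eq_one.2 ⟨b, ?_⟩
    ext d
    simp only [Finset.mem_filter, Finset.mem_univ, true_and, Finset.mem_singleton]
    refine ⟨fun hd => hpi (hinj ?_), ?_⟩
    · rw [hpc, hd, ha]
    · rintro rfl
      rw [← hpc, ha]
  · have : p b = a := hinj ((hpc b).trans h.symm)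
    exact this ▸ hp b

end

/-- The supremum of the degrees in which `Ext(-, N)` does not vanish. -/
def extDim {R : Type} [Ring R] (N : ModuleCat.{0} R) : ℕ∞ :=
  sSup {n : ℕ∞ | ∃ (i : ℕ) (M : ModuleCat.{0} R), n = i ∧ extNZ i M N}

namespace PathStructure

variable {k R : Type} [Field k] [Ring R] [Algebra k R] {Q : Quiv} {rel : Q.Arr → Q.Arr → Prop}

lemma exists_left_maximal_of_extNZ (S : PathStructure k R Q rel) (hg : IsGentleRel Q rel) {n : ℕ}
    {M : ModuleCat.{0} R} (h : extNZ (n + 2) M (ModuleCat.of R R)) :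
    ∃ l : List Q.Arr, l.IsChain rel ∧ l.length = n + 2 ∧ ∀ z, ¬ (z :: l).IsChain rel := by
  by_contra! hc
  exact h (S.subsingleton_ext_of_extendable hg M (n + 1) (by simp) hc)

theorem extDim_of_exists (S : PathStructure k R Q rel) (hg : IsGentleRel Q rel)
    (h : ∃ l : List Q.Arr, FiniteMaxWord (dualRel rel) l) :
    extDim (ModuleCat.of R R) = sSup {x : ℕ∞ | ∃ l : List Q.Arr, FiniteMaxWord (dualRel rel) l ∧
      x = (l.length : ℕ∞)} := by
  refine le_antisymm (sSup_le ?_) (sSup_le ?_)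
  · rintro _ ⟨i, M, rfl, hi⟩
    obtain _ | _ | n := i
    · simp
    · obtain ⟨l, hl⟩ := h
      refine le_sSup_of_le ⟨l, hl, rfl⟩ ?_
      exact_mod_cast List.length_pos_iff.2 ((finiteMaxWord_dualRel_iff hg).1 hl).1
    · obtain ⟨l, hl, hn, hmax⟩ := S.exists_left_maximal_of_extNZ hg hi
      obtain ⟨m, hm, hle⟩ := exists_finiteMaxWord hg
        (List.ne_nil_of_length_eq_add_one hn) hl hmax
      refine le_sSup_of_le ⟨m, hm, rfl⟩ ?_
      rw [hn] at hle
      exact_mod_cast hle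
  · rintro _ ⟨l, hl, rfl⟩
    obtain ⟨hne, hc, -, hmax⟩ := (finiteMaxWord_dualRel_iff hg).1 hl
    obtain ⟨n, hn⟩ := Nat.exists_eq_add_one_of_ne_zero (List.length_pos_iff.2 hne).ne'
    obtain ⟨M, hM⟩ := S.exists_not_subsingleton_ext hg hc hn hmax
    exact le_sSup ⟨n + 1, M, by rw [hn], hM⟩

theorem extDim_of_isAtilde (S : PathStructure k R Q rel) (hg : IsGentleRel Q rel)
    (h : IsAtilde Q ∧ ∀ a b : Q.Arr, Q.tgt a = Q.src b → rel a b) :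
    extDim (ModuleCat.of R R) = 0 := by
  refine le_antisymm (sSup_le ?_) zero_le
  rintro _ ⟨i, M, rfl, hi⟩
  obtain _ | n := i
  · simp
  · refine absurd (S.subsingleton_ext_of_extendable hg M n (fun _ =>
      ⟨fun a b hab => eq_of_indeg_eq_one (h.1 _).1 hab rfl, h.2⟩) fun l hl hn => ?_) hi
    cases l with
    | nil => simp at hn
    | cons a w =>
      obtain ⟨z, hz⟩ := exists_of_indeg_eq_one (h.1 (Q.src a)).1
      exact ⟨z, List.IsChain.cons_cons (h.2 _ _ hz) hl⟩

theorem extDim_of_not_exists (S : PathStructure k R Q rel) (hg : IsGentleRel Q rel)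
    (h : ¬ ∃ l : List Q.Arr, FiniteMaxWord (dualRel rel) l)
    (h' : ¬ (IsAtilde Q ∧ ∀ a b : Q.Arr, Q.tgt a = Q.src b → rel a b)) :
    extDim (ModuleCat.of R R) = 1 := by
  have hext {l : List Q.Arr} (hne : l ≠ []) (hl : l.IsChain rel) : ∃ z, (z :: l).IsChain rel := by
    by_contra! hc
    obtain ⟨m, hm, -⟩ := exists_finiteMaxWord hg hne hl hc
    exact h ⟨m, hm⟩
  refine le_antisymm (sSup_le ?_) ?_
  · rintro _ ⟨i, M, rfl, hi⟩
    obtain _ | _ | n := i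
    · simp
    · simp
    · obtain ⟨l, hl, hn, hmax⟩ := S.exists_left_maximal_of_extNZ hg hi
      obtain ⟨z, hz⟩ := hext (List.ne_nil_of_length_eq_add_one hn) hl
      exact absurd hz (hmax z)
  · by_cases hinj : Function.Injective Q.tgt
    · refine absurd (isAtilde_of_extendable hg hinj fun a => ?_) h'
      obtain ⟨z, hz⟩ := hext (l := [a]) (by simp) (by simp)
      exact ⟨z, by simpa using hz⟩
    · simp only [Function.Injective, not_forall] at hinj
      obtain ⟨a, b, ht, hab⟩ := hinj
      obtain ⟨M, hM⟩ := S.exists_not_subsingleton_ext_one hg hab ht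
      exact le_sSup ⟨1, M, by simp, hM⟩

end PathStructure

section
variable (k : Type) [Field k] (Q : Quiv) (rel : Q.Arr → Q.Arr → Prop)

lemma vtx_mul_self (v : Q.V) : vtx k Q rel v * vtx k Q rel v = vtx k Q rel v := by
  rw [vtx, ← map_mul, RingQuot.mkAlgHom_rel k (GARel.idem v)]

lemma vtx_mul_of_ne {v w : Q.V} (h : v ≠ w) : vtx k Q rel v * vtx k Q rel w = 0 := by
  rw [vtx, vtx, ← map_mul, RingQuot.mkAlgHom_rel k (GARel.orth v w h), map_zero]

lemma sum_vtx : ∑ v, vtx k Q rel v = 1 := by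
  simp only [vtx]
  rw [← map_sum, RingQuot.mkAlgHom_rel k GARel.unit, map_one]

lemma vtx_src_mul_arr (a : Q.Arr) : vtx k Q rel (Q.src a) * arr k Q rel a = arr k Q rel a := by
  rw [vtx, arr, ← map_mul, RingQuot.mkAlgHom_rel k (GARel.src_mul a)]

lemma arr_mul_vtx_tgt (a : Q.Arr) : arr k Q rel a * vtx k Q rel (Q.tgt a) = arr k Q rel a := by
  rw [vtx, arr, ← map_mul, RingQuot.mkAlgHom_rel k (GARel.mul_tgt a)]

lemma vtx_mul_arr_of_ne {v : Q.V} {a : Q.Arr} (h : v ≠ Q.src a) :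
    vtx k Q rel v * arr k Q rel a = 0 := by
  rw [vtx, arr, ← map_mul, RingQuot.mkAlgHom_rel k (GARel.src_zero v a h), map_zero]

lemma arr_mul_vtx_of_ne {v : Q.V} {a : Q.Arr} (h : v ≠ Q.tgt a) :
    arr k Q rel a * vtx k Q rel v = 0 := by
  rw [vtx, arr, ← map_mul, RingQuot.mkAlgHom_rel k (GARel.tgt_zero v a h), map_zero]

variable {rel} in
lemma arr_mul_arr_of_rel {a b : Q.Arr} (h : rel a b) : arr k Q rel a * arr k Q rel b = 0 := by
  rw [arr, arr, ← map_mul, RingQuot.mkAlgHom_rel k (GARel.rel_zero a b h), map_zero]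

lemma arr_mul_arr_of_ne {a b : Q.Arr} (h : Q.tgt a ≠ Q.src b) :
    arr k Q rel a * arr k Q rel b = 0 := by
  rw [← arr_mul_vtx_tgt, mul_assoc, vtx_mul_arr_of_ne _ _ _ h, mul_zero]

/-- A function on paths, extended by linearity. -/
abbrev PathSpace : Type := (List Q.Arr × Q.V) →₀ k

/-- The source of a word, with a default value. -/
def start : List Q.Arr × Q.V → Q.V
  | ([], t) => t
  | (a :: _, _) => Q.src a

/-- The word does not begin with an arrow `b` such that `ab` is a relation. -/
def Follows (a : Q.Arr) : List Q.Arr × Q.V → Prop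
  | ([], _) => True
  | (b :: _, _) => ¬ rel a b

/-- Left multiplication by a stationary path on the space of paths. -/
def vtxAct (v : Q.V) : Module.End k (PathSpace k Q) :=
  Finsupp.lsum k fun p => if start Q p = v then Finsupp.lsingle p else 0

open Classical in
/-- Left multiplication by an arrow on the space of paths. -/
def arrAct (a : Q.Arr) : Module.End k (PathSpace k Q) :=
  Finsupp.lsum k fun p =>
    if start Q p = Q.tgt a ∧ Follows Q rel a p then Finsupp.lsingle (a :: p.1, p.2) else 0

lemma vtxAct_single (v : Q.V) (p : List Q.Arr × Q.V) :
    vtxAct k Q v (Finsupp.single p 1) = if start Q p = v then Finsupp.single p 1 else 0 := by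
  simp only [vtxAct, Finsupp.lsum_single]
  split_ifs <;> simp

open Classical in
lemma arrAct_single (a : Q.Arr) (p : List Q.Arr × Q.V) :
    arrAct k Q rel a (Finsupp.single p 1) =
      if start Q p = Q.tgt a ∧ Follows Q rel a p then Finsupp.single (a :: p.1, p.2) 1 else 0 := by
  simp only [arrAct, Finsupp.lsum_single]
  split_ifs <;> simp

variable {k Q} in
lemma pathSpace_hom_ext {N : Type} [AddCommMonoid N] [Module k N] {f g : PathSpace k Q →ₗ[k] N}
    (h : ∀ p, f (Finsupp.single p 1) = g (Finsupp.single p 1)) : f = g :=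
  Finsupp.lhom_ext' fun p => LinearMap.ext_ring (h p)

/-- The action of the free algebra on the space of paths. -/
def pathActAux : FreeAlgebra k (Q.V ⊕ Q.Arr) →ₐ[k] Module.End k (PathSpace k Q) :=
  FreeAlgebra.lift k (Sum.elim (vtxAct k Q) (arrAct k Q rel))

lemma pathActAux_rel ⦃x y : FreeAlgebra k (Q.V ⊕ Q.Arr)⦄ (h : GARel k Q rel x y) :
    pathActAux k Q rel x = pathActAux k Q rel y := by
  classical
  cases h <;> refine pathSpace_hom_ext fun p => ?_ <;>
    simp only [pathActAux, map_mul, map_sum, map_one, map_zero, FreeAlgebra.lift_ι_apply,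
      Sum.elim_inl, Sum.elim_inr, Module.End.mul_apply, Module.End.one_apply, LinearMap.sum_apply,
      LinearMap.zero_apply, vtxAct_single, arrAct_single]
  case idem v => split_ifs <;> simp [vtxAct_single, *]
  case orth v w h => split_ifs with h' <;> simp [vtxAct_single, h', h.symm]
  case unit => simp
  case src_mul a => split_ifs <;> simp [vtxAct_single, start]
  case mul_tgt a => split_ifs <;> simp_all [arrAct_single]
  case src_zero v a h => split_ifs <;> simp [vtxAct_single, start, h.symm]
  case tgt_zero v a h => split_ifs with h' <;> simp [arrAct_single, h', h]
  case rel_zero a b h => split_ifs <;> simp [arrAct_single, Follows, h]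

/-- The action of `A` on the space of paths. -/
def pathAct : GA k Q rel →ₐ[k] Module.End k (PathSpace k Q) :=
  RingQuot.liftAlgHom k ⟨pathActAux k Q rel, fun _ _ h => pathActAux_rel k Q rel h⟩

@[simp] lemma pathAct_vtx (v : Q.V) : pathAct k Q rel (vtx k Q rel v) = vtxAct k Q v := by
  rw [pathAct, vtx, RingQuot.liftAlgHom_mkAlgHom_apply, pathActAux, FreeAlgebra.lift_ι_apply,
    Sum.elim_inl]

@[simp] lemma pathAct_arr (a : Q.Arr) : pathAct k Q rel (arr k Q rel a) = arrAct k Q rel a := by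
  rw [pathAct, arr, RingQuot.liftAlgHom_mkAlgHom_apply, pathActAux, FreeAlgebra.lift_ι_apply,
    Sum.elim_inr]

/-- The element of `A` represented by a combination of paths. -/
def ofPaths : PathSpace k Q →ₗ[k] GA k Q rel :=
  Finsupp.lsum k fun p => LinearMap.toSpanSingleton k _ (wordEl k Q rel p.1 * vtx k Q rel p.2)

@[simp] lemma ofPaths_single (p : List Q.Arr × Q.V) :
    ofPaths k Q rel (Finsupp.single p 1) = wordEl k Q rel p.1 * vtx k Q rel p.2 := by
  simp [ofPaths]

/-- The expansion of an element of `A` as a combination of paths. -/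
def toPaths : GA k Q rel →ₗ[k] PathSpace k Q where
  toFun y := pathAct k Q rel y (∑ t, Finsupp.single ([], t) 1)
  map_add' y z := by rw [map_add, LinearMap.add_apply]
  map_smul' r y := by rw [map_smul, LinearMap.smul_apply, RingHom.id_apply]

lemma toPaths_mul (y z : GA k Q rel) :
    toPaths k Q rel (y * z) = pathAct k Q rel y (toPaths k Q rel z) := by
  simp [toPaths]

lemma wordEl_cons (a : Q.Arr) (w : List Q.Arr) :
    wordEl k Q rel (a :: w) = arr k Q rel a * wordEl k Q rel w := by
  simp [wordEl]

lemma wordEl_nil : wordEl k Q rel [] = 1 := by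
  simp [wordEl]

lemma vtx_mul_word (v : Q.V) (p : List Q.Arr × Q.V) :
    vtx k Q rel v * (wordEl k Q rel p.1 * vtx k Q rel p.2) =
      if start Q p = v then wordEl k Q rel p.1 * vtx k Q rel p.2 else 0 := by
  obtain ⟨_ | ⟨a, w⟩, t⟩ := p
  · simp only [start, wordEl_nil, one_mul]
    split_ifs with h
    · rw [h, vtx_mul_self]
    · rw [vtx_mul_of_ne _ _ _ (Ne.symm h)]
  · simp only [start, wordEl_cons, ← mul_assoc]
    split_ifs with h
    · rw [← h, vtx_src_mul_arr]
    · rw [vtx_mul_arr_of_ne _ _ _ (Ne.symm h), zero_mul, zero_mul]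

open Classical in
lemma arr_mul_word (a : Q.Arr) (p : List Q.Arr × Q.V) :
    arr k Q rel a * (wordEl k Q rel p.1 * vtx k Q rel p.2) =
      if start Q p = Q.tgt a ∧ Follows Q rel a p then
        wordEl k Q rel (a :: p.1) * vtx k Q rel p.2 else 0 := by
  split_ifs with h
  · rw [wordEl_cons, mul_assoc]
  · obtain ⟨_ | ⟨b, w⟩, t⟩ := p
    · simp only [start, Follows, and_true] at h
      rw [wordEl_nil, one_mul, arr_mul_vtx_of_ne _ _ _ h]
    · simp only [start, Follows, not_and_or, not_not] at h
      rw [wordEl_cons, ← mul_assoc, ← mul_assoc]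
      obtain h | h := h
      · rw [arr_mul_arr_of_ne _ _ _ (Ne.symm h), zero_mul, zero_mul]
      · rw [arr_mul_arr_of_rel _ _ h, zero_mul, zero_mul]

lemma ofPaths_vtxAct (v : Q.V) (f : PathSpace k Q) :
    ofPaths k Q rel (vtxAct k Q v f) = vtx k Q rel v * ofPaths k Q rel f := by
  refine LinearMap.congr_fun (f := ofPaths k Q rel ∘ₗ vtxAct k Q v)
    (g := LinearMap.mulLeft k (vtx k Q rel v) ∘ₗ ofPaths k Q rel) (pathSpace_hom_ext fun p => ?_) f
  simp only [LinearMap.comp_apply, LinearMap.mulLeft_apply, vtxAct_single, ofPaths_single,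
    vtx_mul_word]
  split_ifs <;> simp

lemma ofPaths_arrAct (a : Q.Arr) (f : PathSpace k Q) :
    ofPaths k Q rel (arrAct k Q rel a f) = arr k Q rel a * ofPaths k Q rel f := by
  classical
  refine LinearMap.congr_fun (f := ofPaths k Q rel ∘ₗ arrAct k Q rel a)
    (g := LinearMap.mulLeft k (arr k Q rel a) ∘ₗ ofPaths k Q rel) (pathSpace_hom_ext fun p => ?_) f
  simp only [LinearMap.comp_apply, LinearMap.mulLeft_apply, arrAct_single, ofPaths_single,
    arr_mul_word]
  split_ifs <;> simp

variable {k Q rel} in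
lemma ga_induction {p : GA k Q rel → Prop} (algebraMap : ∀ r, p (algebraMap k _ r))
    (vtx : ∀ v, p (vtx k Q rel v)) (arr : ∀ a, p (arr k Q rel a))
    (mul : ∀ y z, p y → p z → p (y * z)) (add : ∀ y z, p y → p z → p (y + z)) (y) : p y := by
  obtain ⟨y, rfl⟩ := RingQuot.mkAlgHom_surjective k _ y
  induction y using FreeAlgebra.induction with
  | grade0 r => rw [AlgHom.commutes]; exact algebraMap r
  | grade1 x =>
    cases x with
    | inl v => exact vtx v
    | inr a => exact arr a
  | mul y z hy hz => rw [map_mul]; exact mul _ _ hy hz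
  | add y z hy hz => rw [map_add]; exact add _ _ hy hz

lemma ofPaths_pathAct (y : GA k Q rel) (f : PathSpace k Q) :
    ofPaths k Q rel (pathAct k Q rel y f) = y * ofPaths k Q rel f := by
  induction y using ga_induction generalizing f with
  | algebraMap r =>
    rw [AlgHom.commutes, Module.algebraMap_end_apply, map_smul, Algebra.smul_def]
  | vtx v => rw [pathAct_vtx, ofPaths_vtxAct]
  | arr a => rw [pathAct_arr, ofPaths_arrAct]
  | mul y z hy hz => rw [map_mul, Module.End.mul_apply, hy, hz, mul_assoc]
  | add y z hy hz => rw [map_add, LinearMap.add_apply, map_add, hy, hz, add_mul]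

@[simp] lemma ofPaths_toPaths (y : GA k Q rel) : ofPaths k Q rel (toPaths k Q rel y) = y := by
  change ofPaths k Q rel (pathAct k Q rel y _) = y
  rw [ofPaths_pathAct, map_sum]
  simp [wordEl_nil, sum_vtx]

lemma eq_top_of_arr_mul (p : Submodule k (GA k Q rel)) (hv : ∀ v, vtx k Q rel v ∈ p)
    (ha : ∀ y ∈ p, ∀ a, arr k Q rel a * y ∈ p) : p = ⊤ := by
  refine eq_top_iff.2 fun y _ => ?_
  rw [← ofPaths_toPaths k Q rel y]
  induction toPaths k Q rel y using Finsupp.induction_linear with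
  | zero => simp
  | add f g hf hg => rw [map_add]; exact p.add_mem hf hg
  | single q r =>
    rw [← mul_one r, ← smul_eq_mul, ← Finsupp.smul_single, map_smul, ofPaths_single]
    refine p.smul_mem _ ?_
    obtain ⟨w, t⟩ := q
    induction w with
    | nil => simpa [wordEl_nil] using hv t
    | cons a w ih => rw [wordEl_cons, mul_assoc]; exact ha _ ih a

/-- Removal of the first arrow of a path. -/
def stripAct (a : Q.Arr) : Module.End k (PathSpace k Q) :=
  Finsupp.lsum k fun p =>
    match p with
    | ([], _) => 0
    | (b :: w, t) => if a = b then Finsupp.lsingle (w, t) else 0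

@[simp] lemma stripAct_nil (a : Q.Arr) (t : Q.V) :
    stripAct k Q a (Finsupp.single ([], t) 1) = 0 := by
  simp [stripAct]

@[simp] lemma stripAct_cons (a b : Q.Arr) (w : List Q.Arr) (t : Q.V) :
    stripAct k Q a (Finsupp.single (b :: w, t) 1) =
      if a = b then Finsupp.single (w, t) 1 else 0 := by
  simp only [stripAct, Finsupp.lsum_single]
  split_ifs <;> simp

/-- The operator stripping the arrow `a` off the left end of a path. -/
def leftStrip (a : Q.Arr) : GA k Q rel →ₗ[k] GA k Q rel :=
  ofPaths k Q rel ∘ₗ stripAct k Q a ∘ₗ toPaths k Q rel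

lemma leftStrip_vtx (a : Q.Arr) (v : Q.V) : leftStrip k Q rel a (vtx k Q rel v) = 0 := by
  simp only [leftStrip, LinearMap.comp_apply, toPaths, LinearMap.coe_mk, AddHom.coe_mk, pathAct_vtx,
    map_sum, vtxAct_single, start]
  refine Finset.sum_eq_zero fun t _ => ?_
  by_cases h : t = v <;> simp [h]

lemma leftStrip_arr_mul (hc : ∀ a b, rel a b → Q.tgt a = Q.src b) (a : Q.Arr) (y : GA k Q rel) :
    leftStrip k Q rel a (arr k Q rel a * y) = vtx k Q rel (Q.tgt a) * y -
      ∑ z, open Classical in if rel a z then arr k Q rel z * leftStrip k Q rel z y else 0 := by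
  classical
  suffices ofPaths k Q rel ∘ₗ stripAct k Q a ∘ₗ arrAct k Q rel a +
      ∑ z, (if rel a z then LinearMap.mulLeft k (arr k Q rel z) ∘ₗ ofPaths k Q rel ∘ₗ
        stripAct k Q z else 0) =
      LinearMap.mulLeft k (vtx k Q rel (Q.tgt a)) ∘ₗ ofPaths k Q rel by
    have h := LinearMap.congr_fun this (toPaths k Q rel y)
    simp only [LinearMap.add_apply, LinearMap.comp_apply, LinearMap.sum_apply,
      LinearMap.mulLeft_apply, ofPaths_toPaths] at h
    rw [eq_sub_iff_add_eq, ← h, leftStrip, LinearMap.comp_apply, LinearMap.comp_apply, toPaths_mul,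
      pathAct_arr]
    congr 1
    refine Finset.sum_congr rfl fun z _ => ?_
    split_ifs <;> rfl
  refine pathSpace_hom_ext fun ⟨w, t⟩ => ?_
  rw [LinearMap.add_apply, LinearMap.comp_apply, LinearMap.comp_apply, LinearMap.sum_apply,
    LinearMap.comp_apply, LinearMap.mulLeft_apply, ofPaths_single, arrAct_single, vtx_mul_word]
  cases w with
  | nil =>
    rw [Finset.sum_eq_zero fun z _ => by split_ifs <;> simp]
    by_cases h : t = Q.tgt a <;> simp [start, Follows, h]
  | cons b w =>
    rw [Finset.sum_eq_single b (fun z _ hz => by split_ifs <;> simp [hz]) (by simp)]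
    have := hc a b
    simp only [start, Follows]
    by_cases h1 : rel a b
    · simp [h1, (this h1).symm, wordEl_cons, mul_assoc]
    · by_cases h2 : Q.src b = Q.tgt a <;> simp [h1, h2]

lemma leftStrip_arr_mul_of_ne {a b : Q.Arr} (h : a ≠ b) (y : GA k Q rel) :
    leftStrip k Q rel a (arr k Q rel b * y) = 0 := by
  classical
  simp only [leftStrip, LinearMap.comp_apply, toPaths_mul, pathAct_arr]
  refine LinearMap.congr_fun (f := ofPaths k Q rel ∘ₗ stripAct k Q a ∘ₗ arrAct k Q rel b)
    (g := 0) (pathSpace_hom_ext fun p => ?_) _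
  simp only [LinearMap.comp_apply, arrAct_single]
  split_ifs <;> simp [h]

lemma leftStrip_vtx_mul (a : Q.Arr) (v : Q.V) (y : GA k Q rel) :
    leftStrip k Q rel a (vtx k Q rel v * y) =
      if v = Q.src a then leftStrip k Q rel a y else 0 := by
  simp only [leftStrip, LinearMap.comp_apply, toPaths_mul, pathAct_vtx]
  suffices stripAct k Q a ∘ₗ vtxAct k Q v = if v = Q.src a then stripAct k Q a else 0 by
    have h := LinearMap.congr_fun this (toPaths k Q rel y)
    rw [LinearMap.comp_apply] at h
    rw [h]
    split_ifs <;> simp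
  refine pathSpace_hom_ext fun ⟨w, t⟩ => ?_
  rw [LinearMap.comp_apply, vtxAct_single]
  cases w with
  | nil => split_ifs <;> simp
  | cons b w =>
    by_cases hab : a = b
    · subst hab
      by_cases hv : v = Q.src a <;> simp [start, hv, eq_comm]
    · split_ifs <;> simp [hab]

end

section OppositeAlgebra
open MulOpposite

/-- The opposite quiver. -/
@[reducible] def Quiv.op (Q : Quiv) : Quiv where
  V := Q.V
  Arr := Q.Arr
  src := Q.tgt
  tgt := Q.src
  connected := by
    convert Q.connected using 1
    ext v w
    simp only [SimpleGraph.fromRel_adj, and_comm]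
    exact and_congr_right fun _ => or_comm

section
variable (k : Type) [Field k] (Q : Quiv) (rel : Q.Arr → Q.Arr → Prop)

/-- The canonical map to the opposite of the algebra of the opposite quiver, on generators. -/
def toOpAux : FreeAlgebra k (Q.V ⊕ Q.Arr) →ₐ[k] (GA k Q.op (flip rel))ᵐᵒᵖ :=
  FreeAlgebra.lift k (Sum.elim (fun v => op (vtx k Q.op (flip rel) v))
    (fun a => op (arr k Q.op (flip rel) a)))

lemma toOpAux_rel ⦃x y : FreeAlgebra k (Q.V ⊕ Q.Arr)⦄ (h : GARel k Q rel x y) :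
    toOpAux k Q rel x = toOpAux k Q rel y := by
  apply unop_injective
  cases h <;>
    simp only [toOpAux, map_mul, map_sum, map_one, map_zero, FreeAlgebra.lift_ι_apply,
      Sum.elim_inl, Sum.elim_inr, unop_mul, unop_op, unop_one, unop_zero, Finset.unop_sum]
  case idem v => exact vtx_mul_self k Q.op _ v
  case orth v w h => exact vtx_mul_of_ne k Q.op _ h.symm
  case unit => exact sum_vtx k Q.op _
  case src_mul a => exact arr_mul_vtx_tgt k Q.op _ a
  case mul_tgt a => exact vtx_src_mul_arr k Q.op _ a
  case src_zero v a h => exact arr_mul_vtx_of_ne k Q.op _ h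
  case tgt_zero v a h => exact vtx_mul_arr_of_ne k Q.op _ h
  case rel_zero a b h => exact arr_mul_arr_of_rel k Q.op (rel := flip rel) h

/-- The canonical map to the opposite of the algebra of the opposite quiver. -/
def toOp : GA k Q rel →ₐ[k] (GA k Q.op (flip rel))ᵐᵒᵖ :=
  RingQuot.liftAlgHom k ⟨toOpAux k Q rel, fun _ _ h => toOpAux_rel k Q rel h⟩

@[simp] lemma toOp_vtx (v : Q.V) : toOp k Q rel (vtx k Q rel v) = op (vtx k Q.op (flip rel) v) := by
  rw [toOp, vtx, RingQuot.liftAlgHom_mkAlgHom_apply, toOpAux, FreeAlgebra.lift_ι_apply,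
    Sum.elim_inl]

@[simp] lemma toOp_arr (a : Q.Arr) : toOp k Q rel (arr k Q rel a) = op (arr k Q.op (flip rel) a) := by
  rw [toOp, arr, RingQuot.liftAlgHom_mkAlgHom_apply, toOpAux, FreeAlgebra.lift_ι_apply,
    Sum.elim_inr]

/-- The canonical anti-homomorphism, as a linear map. -/
def rev : GA k Q rel →ₗ[k] GA k Q.op (flip rel) :=
  (opLinearEquiv k).symm.toLinearMap ∘ₗ (toOp k Q rel).toLinearMap

lemma rev_apply (y : GA k Q rel) : rev k Q rel y = unop (toOp k Q rel y) := rfl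

lemma rev_vtx (v : Q.V) : rev k Q rel (vtx k Q rel v) = vtx k Q.op (flip rel) v := by
  rw [rev_apply, toOp_vtx, unop_op]

lemma rev_arr (a : Q.Arr) : rev k Q rel (arr k Q rel a) = arr k Q.op (flip rel) a := by
  rw [rev_apply, toOp_arr, unop_op]

lemma rev_mul (y z : GA k Q rel) : rev k Q rel (y * z) = rev k Q rel z * rev k Q rel y := by
  rw [rev_apply, map_mul, unop_mul]
  rfl

lemma rev_one : rev k Q rel 1 = 1 := by
  rw [rev_apply, map_one, unop_one]

/-- The canonical anti-homomorphism from the algebra of the opposite quiver. -/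
def revInv : GA k Q.op (flip rel) →ₗ[k] GA k Q rel := rev k Q.op (flip rel)

lemma revInv_vtx (v : Q.V) : revInv k Q rel (vtx k Q.op (flip rel) v) = vtx k Q rel v :=
  rev_vtx k Q.op (flip rel) v

lemma revInv_arr (a : Q.Arr) : revInv k Q rel (arr k Q.op (flip rel) a) = arr k Q rel a :=
  rev_arr k Q.op (flip rel) a

lemma revInv_mul (y z : GA k Q.op (flip rel)) :
    revInv k Q rel (y * z) = revInv k Q rel z * revInv k Q rel y :=
  rev_mul k Q.op (flip rel) y z

lemma revInv_one : revInv k Q rel 1 = 1 := rev_one k Q.op (flip rel)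

@[simp] lemma revInv_rev (y : GA k Q rel) : revInv k Q rel (rev k Q rel y) = y := by
  induction y using ga_induction with
  | algebraMap r =>
    rw [Algebra.algebraMap_eq_smul_one, map_smul, map_smul, rev_one, revInv_one]
  | vtx v => rw [rev_vtx, revInv_vtx]
  | arr a => rw [rev_arr, revInv_arr]
  | mul y z hy hz => rw [rev_mul, revInv_mul, hy, hz]
  | add y z hy hz => rw [map_add, map_add, hy, hz]

@[simp] lemma rev_revInv (y : GA k Q.op (flip rel)) : rev k Q rel (revInv k Q rel y) = y :=
  revInv_rev k Q.op (flip rel) y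

/-- The operator stripping the arrow `a` off the right end of a path. -/
def rightStrip (a : Q.Arr) : GA k Q rel →ₗ[k] GA k Q rel :=
  revInv k Q rel ∘ₗ leftStrip k Q.op (flip rel) a ∘ₗ rev k Q rel

lemma rightStrip_apply (a : Q.Arr) (y : GA k Q rel) : rightStrip k Q rel a y =
    revInv k Q rel (leftStrip k Q.op (flip rel) a (rev k Q rel y)) := rfl

lemma rightStrip_vtx (a : Q.Arr) (v : Q.V) : rightStrip k Q rel a (vtx k Q rel v) = 0 := by
  rw [rightStrip_apply, rev_vtx, leftStrip_vtx, map_zero]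

lemma rightStrip_mul_arr (hc : ∀ a b, rel a b → Q.tgt a = Q.src b) (a : Q.Arr) (y : GA k Q rel) :
    rightStrip k Q rel a (y * arr k Q rel a) = y * vtx k Q rel (Q.src a) -
      ∑ z, open Classical in if rel z a then rightStrip k Q rel z y * arr k Q rel z else 0 := by
  classical
  rw [rightStrip_apply, rev_mul, rev_arr,
    leftStrip_arr_mul k Q.op (flip rel) fun a b h => (hc b a h).symm, map_sub, map_sum, revInv_mul,
    revInv_vtx, revInv_rev]
  refine congrArg₂ _ rfl (Finset.sum_congr rfl fun z _ => ?_)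
  rw [apply_ite (revInv k Q rel), map_zero, revInv_mul, revInv_arr]
  rfl

lemma rightStrip_mul_arr_of_ne {a b : Q.Arr} (h : a ≠ b) (y : GA k Q rel) :
    rightStrip k Q rel a (y * arr k Q rel b) = 0 := by
  rw [rightStrip_apply, rev_mul, rev_arr, leftStrip_arr_mul_of_ne k Q.op _ h, map_zero]

lemma rightStrip_mul_vtx (a : Q.Arr) (v : Q.V) (y : GA k Q rel) :
    rightStrip k Q rel a (y * vtx k Q rel v) =
      if v = Q.tgt a then rightStrip k Q rel a y else 0 := by
  rw [rightStrip_apply, rev_mul, rev_vtx, leftStrip_vtx_mul, apply_ite (revInv k Q rel), map_zero]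
  rfl

lemma eq_top_of_mul_arr (p : Submodule k (GA k Q rel)) (hv : ∀ v, vtx k Q rel v ∈ p)
    (ha : ∀ y ∈ p, ∀ a, y * arr k Q rel a ∈ p) : p = ⊤ := by
  refine eq_top_iff.2 fun y _ => ?_
  have := eq_top_of_arr_mul k Q.op (flip rel) (p.comap (revInv k Q rel))
    (fun v => by rw [Submodule.mem_comap, revInv_vtx]; exact hv v)
    (fun y hy a => by rw [Submodule.mem_comap, revInv_mul, revInv_arr]; exact ha _ hy a)
  have h : rev k Q rel y ∈ p.comap (revInv k Q rel) := this ▸ Submodule.mem_top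
  rwa [Submodule.mem_comap, revInv_rev] at h

/-- The coefficient of a stationary path. -/
def vtxCoeff (v : Q.V) : GA k Q rel →ₐ[k] k :=
  RingQuot.liftAlgHom k ⟨vtxHomAux k Q v, fun _ _ h => vtxHomAux_rel k Q rel v h⟩

lemma vtxCoeff_vtx (v : Q.V) : vtxCoeff k Q rel v (vtx k Q rel v) = 1 := by
  rw [vtxCoeff, vtx, RingQuot.liftAlgHom_mkAlgHom_apply, vtxHomAux, FreeAlgebra.lift_ι_apply,
    Sum.elim_inl, if_pos rfl]

lemma vtxCoeff_arr (v : Q.V) (a : Q.Arr) : vtxCoeff k Q rel v (arr k Q rel a) = 0 := by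
  rw [vtxCoeff, arr, RingQuot.liftAlgHom_mkAlgHom_apply, vtxHomAux, FreeAlgebra.lift_ι_apply,
    Sum.elim_inr]

variable {rel}

lemma vtx_mul_leftStrip (hc : ∀ a b, rel a b → Q.tgt a = Q.src b) (a : Q.Arr) (y : GA k Q rel) :
    vtx k Q rel (Q.tgt a) * leftStrip k Q rel a y = leftStrip k Q rel a y := by
  classical
  have := eq_top_of_arr_mul k Q rel (LinearMap.eqLocus
    (LinearMap.mulLeft k (vtx k Q rel (Q.tgt a)) ∘ₗ leftStrip k Q rel a) (leftStrip k Q rel a))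
    (fun v => by simp [LinearMap.mem_eqLocus, leftStrip_vtx]) (fun y _ b => by
      rw [LinearMap.mem_eqLocus, LinearMap.comp_apply, LinearMap.mulLeft_apply]
      by_cases h : a = b
      · subst h
        rw [leftStrip_arr_mul k Q rel hc, mul_sub, ← mul_assoc, vtx_mul_self, Finset.mul_sum]
        refine congrArg _ (Finset.sum_congr rfl fun z _ => ?_)
        split_ifs with h
        · rw [← mul_assoc, hc _ _ h, vtx_src_mul_arr]
        · rw [mul_zero]
      · rw [leftStrip_arr_mul_of_ne _ _ _ h, mul_zero])
  exact LinearMap.mem_eqLocus.1 (this ▸ Submodule.mem_top : y ∈ _)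

lemma leftStrip_leftStrip (hc : ∀ a b, rel a b → Q.tgt a = Q.src b) (a b : Q.Arr) (y : GA k Q rel)
    (h : rel a b ∨ Q.tgt a ≠ Q.src b) : leftStrip k Q rel b (leftStrip k Q rel a y) = 0 := by
  classical
  have := eq_top_of_arr_mul k Q rel (⨅ (a) (b) (_ : rel a b ∨ Q.tgt a ≠ Q.src b),
    LinearMap.ker (leftStrip k Q rel b ∘ₗ leftStrip k Q rel a))
    (fun v => by simp [leftStrip_vtx]) (fun y hy d => by
      simp only [Submodule.mem_iInf, LinearMap.mem_ker, LinearMap.comp_apply] at hy ⊢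
      intro a b h
      by_cases had : a = d
      · subst had
        rw [leftStrip_arr_mul k Q rel hc, map_sub, map_sum, leftStrip_vtx_mul]
        by_cases hab : rel a b
        · rw [Finset.sum_eq_single b, if_pos hab, if_pos (hc _ _ hab), leftStrip_arr_mul k Q rel hc,
            vtx_mul_leftStrip k Q hc, sub_sub_cancel]
          · refine Finset.sum_eq_zero fun z _ => ?_
            split_ifs with hz
            · rw [hy b z (Or.inl hz), mul_zero]
            · rfl
          · intro z _ hz
            split_ifs
            · rw [leftStrip_arr_mul_of_ne _ _ _ hz.symm]
            · rw [map_zero]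
          · simp
        · have hab' := h.resolve_left hab
          rw [if_neg hab', zero_sub, neg_eq_zero]
          refine Finset.sum_eq_zero fun z _ => ?_
          split_ifs with hz
          · rw [leftStrip_arr_mul_of_ne]
            rintro rfl
            exact hab hz
          · rw [map_zero]
      · rw [leftStrip_arr_mul_of_ne _ _ _ had, map_zero])
  have hy : y ∈ ⨅ (a) (b) (_ : rel a b ∨ Q.tgt a ≠ Q.src b),
    LinearMap.ker (leftStrip k Q rel b ∘ₗ leftStrip k Q rel a) := this ▸ Submodule.mem_top
  simp only [Submodule.mem_iInf] at hy
  exact hy a b h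

lemma rightStrip_mul_vtx_src (hc : ∀ a b, rel a b → Q.tgt a = Q.src b) (a : Q.Arr)
    (y : GA k Q rel) :
    rightStrip k Q rel a y * vtx k Q rel (Q.src a) = rightStrip k Q rel a y := by
  rw [rightStrip_apply, ← revInv_vtx, ← revInv_mul]
  exact congrArg _ (vtx_mul_leftStrip k Q.op (rel := flip rel) (fun a b h => (hc b a h).symm) a _)

lemma rightStrip_rightStrip (hc : ∀ a b, rel a b → Q.tgt a = Q.src b) (a b : Q.Arr)
    (y : GA k Q rel) (h : rel b a ∨ Q.src a ≠ Q.tgt b) :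
    rightStrip k Q rel b (rightStrip k Q rel a y) = 0 := by
  rw [rightStrip_apply, rightStrip_apply, rev_revInv,
    leftStrip_leftStrip k Q.op (rel := flip rel) (fun a b h => (hc b a h).symm) a b _ h, map_zero]

/-- The path structure of a (locally) gentle algebra. -/
def pathStructure (hc : ∀ a b, rel a b → Q.tgt a = Q.src b) :
    PathStructure k (GA k Q rel) Q rel where
  e := vtx k Q rel
  x := arr k Q rel
  c := vtxCoeff k Q rel
  ls := leftStrip k Q rel
  rs := rightStrip k Q rel
  e_mul_self := vtx_mul_self k Q rel
  e_mul_of_ne _ _ := vtx_mul_of_ne k Q rel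
  sum_e := sum_vtx k Q rel
  e_mul_x := vtx_src_mul_arr k Q rel
  x_mul_e := arr_mul_vtx_tgt k Q rel
  x_mul_x _ _ := arr_mul_arr_of_rel k Q
  c_e := vtxCoeff_vtx k Q rel
  c_x := vtxCoeff_arr k Q rel
  ls_e := leftStrip_vtx k Q rel
  ls_x_mul := leftStrip_arr_mul k Q rel hc
  ls_x_mul_of_ne _ _ y h := leftStrip_arr_mul_of_ne k Q rel h y
  e_mul_ls := vtx_mul_leftStrip k Q hc
  ls_ls := leftStrip_leftStrip k Q hc
  ls_e_mul a y := by rw [leftStrip_vtx_mul, if_pos rfl]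
  ls_e_mul_of_ne a v y h := by rw [leftStrip_vtx_mul, if_neg h]
  rs_e := rightStrip_vtx k Q rel
  rs_mul_x := rightStrip_mul_arr k Q rel hc
  rs_mul_x_of_ne _ _ y h := rightStrip_mul_arr_of_ne k Q rel h y
  rs_mul_e := rightStrip_mul_vtx_src k Q hc
  rs_rs := rightStrip_rightStrip k Q hc
  rs_e_mul a y := by rw [rightStrip_mul_vtx, if_pos rfl]
  rs_e_mul_of_ne a v y h := by rw [rightStrip_mul_vtx, if_neg h]
  eq_top_of_mul_x := eq_top_of_mul_arr k Q rel
  eq_top_of_x_mul := eq_top_of_arr_mul k Q rel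

end

namespace PathStructure

variable {k R : Type} [Field k] [Ring R] [Algebra k R] {Q : Quiv} {rel : Q.Arr → Q.Arr → Prop}

/-- The conjugate of a linear map on the opposite algebra. -/
def opMap (f : R →ₗ[k] R) : Rᵐᵒᵖ →ₗ[k] Rᵐᵒᵖ :=
  (opLinearEquiv k).toLinearMap ∘ₗ f ∘ₗ (opLinearEquiv k).symm.toLinearMap

lemma comap_op_eq_top {p : Submodule k Rᵐᵒᵖ}
    (h : p.comap (opLinearEquiv k : R ≃ₗ[k] Rᵐᵒᵖ).toLinearMap = ⊤) : p = ⊤ :=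
  eq_top_iff.2 fun y _ => (h ▸ Submodule.mem_top :
    unop y ∈ p.comap (opLinearEquiv k : R ≃ₗ[k] Rᵐᵒᵖ).toLinearMap)

/-- The path structure of the opposite algebra. -/
def opposite (S : PathStructure k R Q rel) : PathStructure k Rᵐᵒᵖ Q.op (flip rel) where
  e v := op (S.e v)
  x a := op (S.x a)
  c v := (S.c v).fromOpposite fun _ _ => mul_comm _ _
  ls a := opMap (S.rs a)
  rs a := opMap (S.ls a)
  e_mul_self v := congrArg op (S.e_mul_self v)
  e_mul_of_ne v w h := congrArg op (S.e_mul_of_ne w v h.symm)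
  sum_e := by rw [← op_one, ← S.sum_e, Finset.op_sum]
  e_mul_x a := congrArg op (S.x_mul_e a)
  x_mul_e a := congrArg op (S.e_mul_x a)
  x_mul_x a b h := congrArg op (S.x_mul_x b a h)
  c_e v := S.c_e v
  c_x v a := S.c_x v a
  ls_e a v := congrArg op (S.rs_e a v)
  ls_x_mul a y := (congrArg op (S.rs_mul_x a (unop y))).trans (by
    rw [MulOpposite.op_sub, Finset.op_sum]
    refine congrArg₂ _ rfl (Finset.sum_congr rfl fun z _ => ?_)
    rw [apply_ite op]
    rfl)
  ls_x_mul_of_ne a b y h := congrArg op (S.rs_mul_x_of_ne a b (unop y) h)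
  e_mul_ls a y := congrArg op (S.rs_mul_e a (unop y))
  ls_ls a b y h := congrArg op (S.rs_rs a b (unop y) h)
  ls_e_mul a y := congrArg op (S.rs_e_mul a (unop y))
  ls_e_mul_of_ne a v y h := congrArg op (S.rs_e_mul_of_ne a v (unop y) h)
  rs_e a v := congrArg op (S.ls_e a v)
  rs_mul_x a y := (congrArg op (S.ls_x_mul a (unop y))).trans (by
    rw [MulOpposite.op_sub, Finset.op_sum]
    refine congrArg₂ _ rfl (Finset.sum_congr rfl fun z _ => ?_)
    rw [apply_ite op]
    rfl)
  rs_mul_x_of_ne a b y h := congrArg op (S.ls_x_mul_of_ne a b (unop y) h)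
  rs_mul_e a y := congrArg op (S.e_mul_ls a (unop y))
  rs_rs a b y h := congrArg op (S.ls_ls a b (unop y) h)
  rs_e_mul a y := congrArg op (S.ls_e_mul a (unop y))
  rs_e_mul_of_ne a v y h := congrArg op (S.ls_e_mul_of_ne a v (unop y) h)
  eq_top_of_mul_x p hv ha := comap_op_eq_top (S.eq_top_of_x_mul _ hv fun y hy a => ha _ hy a)
  eq_top_of_x_mul p hv ha := comap_op_eq_top (S.eq_top_of_mul_x _ hv fun y hy a => ha _ hy a)

end PathStructure

section
variable {Q : Quiv} {rel : Q.Arr → Q.Arr → Prop}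

lemma IsGentleRel.op (hg : IsGentleRel Q rel) : IsGentleRel Q.op (flip rel) where
  indeg_le := hg.outdeg_le
  outdeg_le := hg.indeg_le
  rel_comp a b h := (hg.rel_comp b a h).symm
  cond_ii a b b' h hb hb' := hg.cond_iii a b b' h hb.symm hb'.symm
  cond_iii a b b' h hb hb' := hg.cond_ii a b b' h hb.symm hb'.symm

lemma finiteMaxWord_op_iff (hg : IsGentleRel Q rel) {l : List Q.Arr} :
    FiniteMaxWord (Q := Q.op) (dualRel (Q := Q.op) (flip rel)) l ↔
      FiniteMaxWord (dualRel rel) l.reverse := by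
  rw [finiteMaxWord_dualRel_iff hg.op, finiteMaxWord_dualRel_iff hg]
  have h (m : List Q.Arr) : m.IsChain (flip rel) ↔ m.reverse.IsChain rel :=
    List.isChain_reverse.symm
  simp only [h, List.reverse_append, List.reverse_cons, List.reverse_nil, List.nil_append,
    List.singleton_append, ne_eq, List.reverse_eq_nil_iff]
  tauto

lemma exists_finiteMaxWord_op_iff (hg : IsGentleRel Q rel) :
    (∃ l, FiniteMaxWord (Q := Q.op) (dualRel (Q := Q.op) (flip rel)) l) ↔
      ∃ l, FiniteMaxWord (dualRel rel) l := by
  simp only [finiteMaxWord_op_iff hg]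
  exact ⟨fun ⟨l, h⟩ => ⟨_, h⟩, fun ⟨l, h⟩ => ⟨l.reverse, by rwa [List.reverse_reverse]⟩⟩

lemma lengths_finiteMaxWord_op (hg : IsGentleRel Q rel) :
    {x : ℕ∞ | ∃ l, FiniteMaxWord (Q := Q.op) (dualRel (Q := Q.op) (flip rel)) l ∧
      x = (l.length : ℕ∞)} = {x : ℕ∞ | ∃ l, FiniteMaxWord (dualRel rel) l ∧
      x = (l.length : ℕ∞)} := by
  ext x
  simp only [finiteMaxWord_op_iff hg, Set.mem_ofPred_eq]
  constructor
  · rintro ⟨l, h, rfl⟩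
    exact ⟨l.reverse, h, by simp⟩
  · rintro ⟨l, h, rfl⟩
    exact ⟨l.reverse, by rwa [List.reverse_reverse], by simp⟩

lemma isAtilde_op_iff : (IsAtilde Q.op ∧ ∀ a b : Q.op.Arr, Q.op.tgt a = Q.op.src b → flip rel a b) ↔
    IsAtilde Q ∧ ∀ a b : Q.Arr, Q.tgt a = Q.src b → rel a b :=
  and_congr (forall_congr' fun _ => and_comm)
    ⟨fun h a b hab => h b a hab.symm, fun h a b hab => h b a hab.symm⟩

end

lemma extNZ_congr {R : Type} [Ring R] (i : ℕ) (M : ModuleCat R) {N N' : ModuleCat R} (e : N ≅ N') :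
    extNZ i M N ↔ extNZ i M N' :=
  not_congr (((Ext ℤ (ModuleCat R) i).obj (.op M)).mapIso e).toLinearEquiv.toEquiv.subsingleton_congr

lemma extDim_congr {R : Type} [Ring R] {N N' : ModuleCat.{0} R} (e : N ≅ N') :
    extDim N = extDim N' := by
  simp only [extDim, extNZ_congr _ _ e]

lemma rInjDim_eq_extDim (k : Type) [Field k] (Q : Quiv) (rel : Q.Arr → Q.Arr → Prop) :
    rInjDim k Q rel = extDim (ModuleCat.of (GA k Q rel)ᵐᵒᵖ (GA k Q rel)ᵐᵒᵖ) :=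
  extDim_congr (N := AModR k Q rel) (LinearEquiv.toModuleIso
    (X₁ := GA k Q rel) (X₂ := (GA k Q rel)ᵐᵒᵖ)
    { opAddEquiv with map_smul' := fun _ _ => rfl })

lemma lInjDim_eq_extDim (k : Type) [Field k] (Q : Quiv) (rel : Q.Arr → Q.Arr → Prop) :
    lInjDim k Q rel = extDim (ModuleCat.of (GA k Q rel) (GA k Q rel)) := rfl

end OppositeAlgebra

/-- **Theorem 4.21 (thm:injdim).** Let `A = kQ/I` be a (locally) gentle algebra and let
`L'` be the set of finite maximal paths of the Koszul dual `A#` (the finite maximal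
forbidden paths of `A`).  Then the graded left and right self-injective dimensions of `A`
agree, and `injdim A = max{ℓ(p) : p ∈ L'}` if `L' ≠ ∅`; `injdim A = 0` if
`A = kÃ_n/(kÃ_n)_{≥2}`; and `injdim A = 1` otherwise. -/
theorem statement14 (k : Type) [Field k] [CharZero k] (Q : Quiv)
    (rel : Q.Arr → Q.Arr → Prop) (hgentle : IsGentleRel Q rel) :
    rInjDim k Q rel = lInjDim k Q rel ∧
    ((∃ l : List Q.Arr, FiniteMaxWord (dualRel rel) l) →
      rInjDim k Q rel =
        sSup {x : ℕ∞ | ∃ l : List Q.Arr, FiniteMaxWord (dualRel rel) l ∧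
          x = (l.length : ℕ∞)}) ∧
    ((IsAtilde Q ∧ ∀ a b : Q.Arr, Q.tgt a = Q.src b → rel a b) → rInjDim k Q rel = 0) ∧
    ((¬ ∃ l : List Q.Arr, FiniteMaxWord (dualRel rel) l) →
      ¬ (IsAtilde Q ∧ ∀ a b : Q.Arr, Q.tgt a = Q.src b → rel a b) →
      rInjDim k Q rel = 1) := by
  have S := pathStructure k Q hgentle.rel_comp
  have T := S.opposite
  have hg := hgentle.op
  rw [rInjDim_eq_extDim, lInjDim_eq_extDim]
  have h1 (h : ∃ l : List Q.Arr, FiniteMaxWord (dualRel rel) l) :=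
    (T.extDim_of_exists hg ((exists_finiteMaxWord_op_iff hgentle).2 h)).trans
      (congrArg sSup (lengths_finiteMaxWord_op hgentle))
  have h2 h := T.extDim_of_isAtilde hg (isAtilde_op_iff.2 h)
  have h3 h h' := T.extDim_of_not_exists hg ((exists_finiteMaxWord_op_iff hgentle).not.2 h)
    (isAtilde_op_iff.not.2 h')
  refine ⟨?_, h1, h2, h3⟩
  by_cases h : ∃ l : List Q.Arr, FiniteMaxWord (dualRel rel) l
  · rw [h1 h, S.extDim_of_exists hgentle h]
  · by_cases h' : IsAtilde Q ∧ ∀ a b : Q.Arr, Q.tgt a = Q.src b → rel a b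
    · rw [h2 h', S.extDim_of_isAtilde hgentle h']
    · rw [h3 h h', S.extDim_of_not_exists hgentle h h']

end LocGentle
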